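/- Let S×T be the product continuous bundle RDS on H with skew product Γ, and μ ∈ I_P(H). Then for each finite measurable partition Q of E: h_μ(Γ | D_H) ≤ h_μ(π_E^{-1}Q | D_H) + h(Θ | Q). -/

import Mathlib

open MeasureTheory Set Filter Topology
open scoped ENNReal

namespace RelTail

variable {Ω W : Type*}

/-- The fiber over `ω` of a subset of a product space. -/
def fib (E : Set (Ω × W)) (ω : Ω) : Set W := {x | (ω, x) ∈ E}

/-- Minimal cardinality of a subfamily of the cover `R` whose fibers at `ω` cover the
fiber of `S` at `ω` (with the convention that the empty set needs one element). -/
noncomputable def coverNum (S : Set (Ω × W)) (R : Set (Set (Ω × W))) (ω : Ω) : ℕ :=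
  max 1 (sInf {n : ℕ | ∃ F : Finset (Set (Ω × W)), ↑F ⊆ R ∧ F.card = n ∧
    fib S ω ⊆ ⋃ u ∈ F, fib u ω})

/-- `N(R | Q)(ω) = max_{q ∈ Q} N(q, R)(ω)`. -/
noncomputable def relCoverNum (R Q : Set (Set (Ω × W))) (ω : Ω) : ℕ :=
  ⨆ q ∈ Q, coverNum q R ω

section Meas
variable [MeasurableSpace Ω] [MeasurableSpace W]

/-- A (finite or countable) random cover of `E`. -/
def IsRandomCover (E : Set (Ω × W)) (Q : Set (Set (Ω × W))) : Prop :=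
  Q.Countable ∧ (∀ q ∈ Q, MeasurableSet q) ∧ (∀ q ∈ Q, q ⊆ E) ∧
    ∀ ω, fib E ω ⊆ ⋃ q ∈ Q, fib q ω

/-- An open random cover: a random cover whose fibers are (a.e.) open in the fibers of `E`. -/
def IsOpenRandomCover [TopologicalSpace W] (P : Measure Ω) (E : Set (Ω × W))
    (Q : Set (Set (Ω × W))) : Prop :=
  IsRandomCover E Q ∧
    ∀ q ∈ Q, ∀ᵐ ω ∂P, ∃ U : Set W, IsOpen U ∧ fib q ω = U ∩ fib E ω

end Meas

/-- The join `⋁_{i<n} (Γ^i)^{-1} Q` of a cover (or partition). -/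
def iterJoin {Z : Type*} (Γ : Z → Z) (Q : Set (Set Z)) (n : ℕ) : Set (Set Z) :=
  {s | ∃ f : ℕ → Set Z, (∀ i, f i ∈ Q) ∧ s = ⋂ i ∈ Finset.range n, (Γ^[i]) ⁻¹' (f i)}

/-- `log N(R^{(n)} | Q^{(n)})(ω)`. -/
noncomputable def iterCoverLog (Θ : Ω × W → Ω × W) (R Q : Set (Set (Ω × W))) (n : ℕ)
    (ω : Ω) : ℝ :=
  Real.log (relCoverNum (iterJoin Θ R n) (iterJoin Θ Q n) ω)

/-- The relative tail entropy `h_Θ(R|Q)` of an open random cover `R` w.r.t. a random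
cover `Q`, as a limit (limsup) of `(1/n) ∫ log N(R^{(n)}|Q^{(n)}) dP`. -/
noncomputable def relCoverEnt [MeasurableSpace Ω] (P : Measure Ω) (Θ : Ω × W → Ω × W)
    (R Q : Set (Set (Ω × W))) : ℝ≥0∞ :=
  Filter.atTop.limsup fun n : ℕ => ENNReal.ofReal ((∫ ω, iterCoverLog Θ R Q n ω ∂P) / n)

/-- `h(Θ|Q)`: supremum over all open random covers `R` of `h_Θ(R|Q)`. -/
noncomputable def condTailEnt [MeasurableSpace Ω] [MeasurableSpace W] [TopologicalSpace W]
    (P : Measure Ω) (E : Set (Ω × W)) (Θ : Ω × W → Ω × W) (Q : Set (Set (Ω × W))) : ℝ≥0∞ :=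
  ⨆ R ∈ {R | IsOpenRandomCover P E R}, relCoverEnt P Θ R Q

/-- The relative tail entropy `h*(Θ)`: infimum over all random covers `Q` of `h(Θ|Q)`. -/
noncomputable def tailEnt [MeasurableSpace Ω] [MeasurableSpace W] [TopologicalSpace W]
    (P : Measure Ω) (E : Set (Ω × W)) (Θ : Ω × W → Ω × W) : ℝ≥0∞ :=
  ⨅ Q ∈ {Q | IsRandomCover E Q}, condTailEnt P E Θ Q

/-- The skew product transformation of a bundle RDS. -/
def skew (ϑ : Ω → Ω) (T : Ω → W → W) : Ω × W → Ω × W := fun p => (ϑ p.1, T p.1 p.2)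

/-- A continuous bundle random dynamical system over `(Ω, P, ϑ)` on `E`. -/
structure IsBundleRDS [MeasurableSpace Ω] [MeasurableSpace W] [TopologicalSpace W]
    (P : Measure Ω) (ϑ : Ω → Ω) (E : Set (Ω × W)) (T : Ω → W → W) : Prop where
  measurePreserving : MeasurePreserving ϑ P P
  measurable : Measurable fun p : Ω × W => T p.1 p.2
  mapsTo : ∀ ω, MapsTo (T ω) (fib E ω) (fib E (ϑ ω))
  continuousOn : ∀ᵐ ω ∂P, ContinuousOn (T ω) (fib E ω)

/-- A finite or countable measurable partition of a set `E`. -/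
def IsCountablePartition {Z : Type*} [MeasurableSpace Z] (E : Set Z) (R : Set (Set Z)) : Prop :=
  R.Countable ∧ (∀ s ∈ R, MeasurableSet s) ∧ (∀ s ∈ R, s ⊆ E) ∧
    R.PairwiseDisjoint id ∧ ⋃₀ R = E

/-- The conditional entropy `H_μ(R | m)` of a countable partition `R` given a
sub-σ-algebra `m`, via conditional expectations. -/
noncomputable def partCondEntropy {Z : Type*} (m : MeasurableSpace Z) [MeasurableSpace Z]
    (μ : Measure Z) (R : Set (Set Z)) : ℝ≥0∞ :=
  ∑' r : R, ENNReal.ofReal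
    (∫ z, Real.negMulLog ((μ[(r : Set Z).indicator (fun _ => (1 : ℝ)) | m]) z) ∂μ)

/-- The relative entropy `h_μ(R | m)` of the transformation `Γ` with respect to a
partition `R`, given the sub-σ-algebra `m`. -/
noncomputable def relEntPart {Z : Type*} (m : MeasurableSpace Z) [MeasurableSpace Z]
    (μ : Measure Z) (Γ : Z → Z) (R : Set (Set Z)) : ℝ≥0∞ :=
  Filter.atTop.limsup fun n : ℕ => partCondEntropy m μ (iterJoin Γ R n) / (n : ℝ≥0∞)

/-- The relative entropy `h_μ(Γ | m)` given the sub-σ-algebra `m`: supremum over all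
countable measurable partitions of `E` of finite conditional entropy. -/
noncomputable def relEnt {Z : Type*} (m : MeasurableSpace Z) [MeasurableSpace Z]
    (μ : Measure Z) (Γ : Z → Z) (E : Set Z) : ℝ≥0∞ :=
  ⨆ R ∈ {R | IsCountablePartition E R ∧ partCondEntropy m μ R ≠ ∞}, relEntPart m μ Γ R

/-- The fiberwise boundary `{(ω,x) : x ∈ ∂(R(ω))}` of a subset of a product space. -/
def fibFrontier [TopologicalSpace W] (R : Set (Ω × W)) : Set (Ω × W) :=
  {p | p.2 ∈ frontier (fib R p.1)}

/-- The sub-σ-algebra of `Ω × W₁ × W₂` generated by the first two coordinates,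
i.e. the σ-algebra `{(A × W₂) ∩ ⬝ : A ∈ F × B}`. -/
def firstPairSigma (Ω W₁ W₂ : Type*) [MeasurableSpace Ω] [MeasurableSpace W₁] :
    MeasurableSpace (Ω × W₁ × W₂) :=
  MeasurableSpace.comap (fun p : Ω × W₁ × W₂ => (p.1, p.2.1)) inferInstance

/-- The defect of upper semi-continuity of `f` at `m` relative to the set `S`. -/
noncomputable def uscDefect {M : Type*} [TopologicalSpace M] (f : M → ℝ≥0∞) (S : Set M)
    (m : M) : ℝ≥0∞ :=
  if f m ≠ ∞ then Filter.limsup f (𝓝[S] m) - f m else ∞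

/-- The factor (extension) transformation `(ω, y) ↦ (ω, π_ω y)`. -/
def factorMap {Y X : Type*} (πf : Ω → Y → X) : Ω × Y → Ω × X :=
  fun p => (p.1, πf p.1 p.2)

/-- `T` on `E` is a factor of `S` on `G` via the family `π_ω`. -/
structure IsFactor {Ω X Y : Type*} [MeasurableSpace Ω] [MeasurableSpace X] [MeasurableSpace Y]
    [TopologicalSpace X] [TopologicalSpace Y] (ϑ : Ω → Ω) (E : Set (Ω × X)) (G : Set (Ω × Y))
    (T : Ω → X → X) (S : Ω → Y → Y) (πf : Ω → Y → X) : Prop where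
  measurable : Measurable fun p : Ω × Y => πf p.1 p.2
  mapsTo : ∀ ω, MapsTo (πf ω) (fib G ω) (fib E ω)
  surjOn : ∀ ω, SurjOn (πf ω) (fib G ω) (fib E ω)
  continuousOn : ∀ ω, ContinuousOn (πf ω) (fib G ω)
  semiconj : ∀ ω, ∀ y ∈ fib G ω, πf (ϑ ω) (S ω y) = T ω (πf ω y)

section
open ProbabilityTheory
/-- Minus the logarithm, with values in `[0,∞]`. -/
noncomputable def LL (x : ℝ≥0∞) : ℝ≥0∞ := if x = 0 then ∞ else ENNReal.ofReal (-Real.log x.toReal)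

lemma LL_anti {x y : ℝ≥0∞} (h : x ≤ y) : LL y ≤ LL x := by
  unfold LL
  by_cases hx : x = 0
  · simp [hx]
  by_cases hy' : y = ∞
  · simp [hy']
  have hy : y ≠ 0 := fun h0 => hx (by simpa [h0] using h)
  simp only [hx, hy, if_false]
  apply ENNReal.ofReal_le_ofReal
  have h1 : x.toReal ≤ y.toReal := ENNReal.toReal_mono hy' h
  have h2 : 0 < x.toReal := ENNReal.toReal_pos hx (ne_top_of_le_ne_top hy' h)
  have := Real.log_le_log h2 h1
  linarith

lemma LL_mul (x y : ℝ≥0∞) : LL (x * y) ≤ LL x + LL y := by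
  unfold LL
  by_cases hx : x = 0
  · simp [hx]
  by_cases hy : y = 0
  · simp [hy]
  by_cases hx' : x = ∞
  · simp [hx', ENNReal.top_mul hy]
  by_cases hy' : y = ∞
  · simp [hy', ENNReal.mul_top hx]
  simp only [hx, hy, mul_eq_zero, or_self, if_false, ENNReal.toReal_mul]
  rw [Real.log_mul (ENNReal.toReal_pos hx hx').ne' (ENNReal.toReal_pos hy hy').ne']
  rw [neg_add]
  exact ENNReal.ofReal_add_le

lemma LL_one : LL 1 = 0 := by simp [LL]

lemma LL_prod {ι : Type*} (s : Finset ι) (f : ι → ℝ≥0∞) :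
    LL (∏ i ∈ s, f i) ≤ ∑ i ∈ s, LL (f i) := by
  classical
  induction s using Finset.induction_on with
  | empty => simp [LL_one]
  | insert a s ha ih =>
    rw [Finset.prod_insert ha, Finset.sum_insert ha]
    exact (LL_mul _ _).trans (by gcongr)

lemma LL_inv_nat (N : ℕ) : LL ((N : ℝ≥0∞)⁻¹) = ENNReal.ofReal (Real.log N) := by
  simp [LL, ENNReal.toReal_inv]

lemma LL_measurable : Measurable LL := by
  unfold LL
  refine Measurable.ite (measurableSet_singleton 0) measurable_const ?_
  fun_prop

lemma LL_ne_top {x : ℝ≥0∞} (h : x ≠ 0) : LL x ≠ ∞ := by simp [LL, h]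

lemma mul_LL {p : ℝ≥0∞} (hp : p ≤ 1) : p * LL p = ENNReal.ofReal (Real.negMulLog p.toReal) := by
  by_cases h0 : p = 0
  · simp [h0]
  have ht : p ≠ ∞ := ne_top_of_le_ne_top ENNReal.one_ne_top hp
  simp only [LL, h0, if_false]
  nth_rewrite 1 [← ENNReal.ofReal_toReal ht]
  rw [← ENNReal.ofReal_mul ENNReal.toReal_nonneg, Real.negMulLog]
  congr 1; ring

lemma gibbs_term {p q : ℝ≥0∞} (hp : p ≤ 1) : p * LL p + p ≤ p * LL q + q := by
  by_cases h0 : p = 0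
  · simp [h0]
  by_cases hq : q = 0
  · simp [hq, LL, ENNReal.mul_top h0]
  by_cases hq' : q = ∞
  · simp [hq']
  have ht : p ≠ ∞ := ne_top_of_le_ne_top ENNReal.one_ne_top hp
  have hp0 := ENNReal.toReal_pos h0 ht
  have hq0 := ENNReal.toReal_pos hq hq'
  have hp1 : p.toReal ≤ 1 := by simpa using ENNReal.toReal_mono ENNReal.one_ne_top hp
  have key : p.toReal * (-Real.log p.toReal) + p.toReal
      ≤ p.toReal * (-Real.log q.toReal) + q.toReal := by
    have := Real.log_le_sub_one_of_pos (div_pos hq0 hp0)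
    rw [Real.log_div hq0.ne' hp0.ne'] at this
    have h2 := mul_le_mul_of_nonneg_left this hp0.le
    have h3 : p.toReal * (q.toReal / p.toReal - 1) = q.toReal - p.toReal := by field_simp
    rw [h3] at h2
    linarith
  have hl : 0 ≤ -Real.log p.toReal := by have := Real.log_nonpos hp0.le hp1; linarith
  have e1 : p * LL p + p = ENNReal.ofReal (p.toReal * (-Real.log p.toReal) + p.toReal) := by
    rw [ENNReal.ofReal_add (mul_nonneg hp0.le hl) hp0.le, ENNReal.ofReal_mul hp0.le,
      ENNReal.ofReal_toReal ht]
    simp [LL, h0]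
  have e2 : ENNReal.ofReal (p.toReal * (-Real.log q.toReal) + q.toReal) ≤ p * LL q + q := by
    refine ENNReal.ofReal_add_le.trans ?_
    rw [ENNReal.ofReal_mul hp0.le, ENNReal.ofReal_toReal ht, ENNReal.ofReal_toReal hq']
    simp [LL, hq]
  rw [e1]
  exact (ENNReal.ofReal_le_ofReal key).trans e2

lemma gibbs {ι : Type*} (p q : ι → ℝ≥0∞) (hp : ∑' i, p i = 1) (hq : ∑' i, q i ≤ 1) :
    ∑' i, p i * LL (p i) ≤ ∑' i, p i * LL (q i) := by
  have h1 : ∑' i, p i * LL (p i) + 1 ≤ ∑' i, p i * LL (q i) + 1 := by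
    calc ∑' i, p i * LL (p i) + 1 = ∑' i, (p i * LL (p i) + p i) := by rw [ENNReal.tsum_add, hp]
      _ ≤ ∑' i, (p i * LL (q i) + q i) :=
        ENNReal.tsum_le_tsum fun i => gibbs_term (hp ▸ ENNReal.le_tsum i)
      _ = ∑' i, p i * LL (q i) + ∑' i, q i := ENNReal.tsum_add
      _ ≤ _ := by gcongr
  exact (ENNReal.add_le_add_iff_right ENNReal.one_ne_top).1 h1

lemma tsum_pi_le_one {ι : Type*} : ∀ (n : ℕ) (f : Fin n → ι → ℝ≥0∞)
    (_ : ∀ i, ∑' r, f i r ≤ 1), ∑' g : Fin n → ι, ∏ i, f i (g i) ≤ 1 := by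
  intro n
  induction n with
  | zero => intro f _; simp
  | succ n ih =>
    intro f hf
    rw [← (Fin.consEquiv (fun _ : Fin (n+1) => ι)).tsum_eq, ENNReal.tsum_prod']
    simp only [Fin.consEquiv_apply, Fin.prod_univ_succ, Fin.cons_zero, Fin.cons_succ,
      ENNReal.tsum_mul_left]
    calc ∑' a, f 0 a * ∑' g : Fin n → ι, ∏ i, f i.succ (g i) ≤ ∑' a, f 0 a * 1 := by
          gcongr
          exact ih (fun i => f i.succ) (fun i => hf _)
      _ ≤ 1 := by simpa using hf 0
end

section
open ProbabilityTheory
lemma analytic_inner {α : Type*} [MetricSpace α] [MeasurableSpace α] [BorelSpace α]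
    (μ : Measure α) [IsFiniteMeasure μ] (f : (ℕ → ℕ) → α) (hf : Continuous f)
    (c : ℝ≥0∞) (hc : c < μ (range f)) :
    ∃ K ⊆ range f, MeasurableSet K ∧ c ≤ μ K := by
  have step : ∀ (n : ℕ) (S : {S : Set (ℕ → ℕ) // c < μ (f '' S)}),
      ∃ m : ℕ, c < μ (f '' (S.1 ∩ {x | x n ≤ m})) := by
    intro n S
    have h1 : (⋃ m : ℕ, f '' (S.1 ∩ {x | x n ≤ m})) = f '' S.1 := by
      rw [← image_iUnion, ← inter_iUnion]
      congr 1
      rw [inter_eq_left]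
      intro x _
      exact mem_iUnion.2 ⟨x n, by simp⟩
    have hm : Monotone (fun m : ℕ => f '' (S.1 ∩ {x | x n ≤ m})) := by
      intro a b hab
      apply image_mono
      apply inter_subset_inter_right
      intro x hx
      exact le_trans (α := ℕ) hx hab
    have h2 := S.2
    rw [← h1, hm.measure_iUnion, lt_iSup_iff] at h2
    exact h2
  choose m hm using step
  have h0 : c < μ (f '' univ) := by rwa [image_univ]
  let S : ℕ → {S : Set (ℕ → ℕ) // c < μ (f '' S)} := fun n =>
    Nat.rec ⟨univ, h0⟩ (fun n S => ⟨S.1 ∩ {x | x n ≤ m n S}, hm n S⟩) n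
  let k : ℕ → ℕ := fun n => m n (S n)
  have hS1 : ∀ n, (S (n+1)).1 = (S n).1 ∩ {x | x n ≤ k n} := fun n => rfl
  have hmem : ∀ n x, x ∈ (S n).1 ↔ ∀ i < n, x i ≤ k i := by
    intro n
    induction n with
    | zero => intro x; simp [S]
    | succ n ih =>
      intro x
      rw [hS1, mem_inter_iff, ih, Nat.forall_lt_succ_right]
      rfl
  have hanti : Antitone (fun n => closure (f '' (S n).1)) := by
    apply antitone_nat_of_succ_le
    intro n
    apply closure_mono
    apply image_mono
    rw [hS1]
    exact inter_subset_left
  refine ⟨⋂ n, closure (f '' (S n).1), ?_, ?_, ?_⟩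
  · intro y hy
    rw [mem_iInter] at hy
    have : ∀ n : ℕ, ∃ x ∈ (S n).1, dist y (f x) < 1 / ((n : ℝ) + 1) := by
      intro n
      obtain ⟨_, ⟨x, hx, rfl⟩, hd⟩ := Metric.mem_closure_iff.1 (hy n) (1 / ((n : ℝ) + 1))
        (by positivity)
      exact ⟨x, hx, hd⟩
    choose x hx hd using this
    let M : ℕ → ℕ := fun i => max (k i) ((Finset.range (i+1)).sup fun n => x n i)
    have hcomp : IsCompact (Set.pi univ fun i => Iic (M i)) :=
      isCompact_univ_pi fun i => (finite_Iic (M i)).isCompact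
    have hin : ∀ n, x n ∈ Set.pi univ fun i => Iic (M i) := by
      intro n i _
      by_cases h : i < n
      · exact le_max_of_le_left ((hmem n _).1 (hx n) i h)
      · exact le_max_of_le_right
          (Finset.le_sup (f := fun n => x n i) (Finset.mem_range.2 (by omega)))
    obtain ⟨a, _, φ, hφ, ha⟩ := hcomp.tendsto_subseq hin
    refine ⟨a, ?_⟩
    have h1 : Tendsto (fun n => f (x (φ n))) atTop (𝓝 (f a)) := (hf.tendsto a).comp ha
    have h2 : Tendsto (fun n => f (x n)) atTop (𝓝 y) := by
      rw [tendsto_iff_dist_tendsto_zero]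
      refine squeeze_zero (fun _ => dist_nonneg) (fun n => ?_)
        tendsto_one_div_add_atTop_nhds_zero_nat
      rw [dist_comm]; exact (hd n).le
    exact tendsto_nhds_unique h1 (h2.comp hφ.tendsto_atTop)
  · exact MeasurableSet.iInter fun n => isClosed_closure.measurableSet
  · have := tendsto_measure_iInter_atTop (μ := μ)
      (fun n => (isClosed_closure (s := f '' (S n).1)).measurableSet.nullMeasurableSet) hanti
      ⟨0, measure_ne_top _ _⟩
    refine ge_of_tendsto this (Eventually.of_forall fun n => ?_)
    exact (S n).2.le.trans (measure_mono subset_closure)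

lemma analytic_nullMeasurable {α : Type*} [MetricSpace α] [MeasurableSpace α] [BorelSpace α]
    (μ : Measure α) [IsFiniteMeasure μ] {A : Set α} (hA : AnalyticSet A) :
    NullMeasurableSet A μ := by
  rw [AnalyticSet] at hA
  rcases hA with rfl | ⟨f, hf, rfl⟩
  · exact MeasurableSet.empty.nullMeasurableSet
  by_cases h0 : μ (range f) = 0
  · exact NullMeasurableSet.of_null h0
  obtain ⟨u, -, hu, hul⟩ := exists_seq_strictMono_tendsto' (pos_iff_ne_zero.2 h0)
  choose K hK hKm hKc using fun n => analytic_inner μ f hf (u n) (hu n).2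
  have hsub : (⋃ n, K n) ⊆ range f := iUnion_subset hK
  have hm : MeasurableSet (⋃ n, K n) := MeasurableSet.iUnion hKm
  have hle : μ (range f) ≤ μ (⋃ n, K n) :=
    le_of_tendsto hul (Eventually.of_forall fun n => (hKc n).trans
      (measure_mono (subset_iUnion K n)))
  exact hm.nullMeasurableSet.congr
    (ae_eq_of_subset_of_measure_ge hsub hle hm.nullMeasurableSet (measure_ne_top _ _))

lemma comap_mapNatBool (Ω : Type*) [m : MeasurableSpace Ω] [MeasurableSpace.CountablyGenerated Ω] :
    MeasurableSpace.comap (MeasurableSpace.mapNatBool Ω) inferInstance = m := by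
  apply le_antisymm
  · exact (MeasurableSpace.measurable_mapNatBool Ω).comap_le
  · conv_lhs => rw [← MeasurableSpace.generateFrom_natGeneratingSequence Ω]
    apply MeasurableSpace.generateFrom_le
    rintro _ ⟨n, rfl⟩
    refine ⟨{g | g n = true}, ?_, ?_⟩
    · exact (measurable_pi_apply (X := fun _ : ℕ => Bool) n) (measurableSet_singleton true)
    · ext x; simp [MeasurableSpace.mapNatBool]

lemma proj_nullMeasurable {Ω X : Type*} [MeasurableSpace Ω] [MeasurableSpace.CountablyGenerated Ω]
    [MetricSpace X] [CompactSpace X] [MeasurableSpace X] [BorelSpace X]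
    (P : Measure Ω) [IsProbabilityMeasure P] {A : Set (Ω × X)} (hA : MeasurableSet A) :
    NullMeasurableSet {ω | ∃ x, (ω, x) ∈ A} P := by
  let φ := MeasurableSpace.mapNatBool Ω
  have hφ : Measurable φ := MeasurableSpace.measurable_mapNatBool Ω
  have hcm : (inferInstance : MeasurableSpace (Ω × X)) =
      MeasurableSpace.comap (fun p : Ω × X => (φ p.1, p.2)) inferInstance := by
    conv_lhs => 
      change MeasurableSpace.prod _ _
      rw [← comap_mapNatBool Ω]
    unfold MeasurableSpace.prod
    conv_rhs => 
      change MeasurableSpace.comap _ (MeasurableSpace.prod _ _)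
    unfold MeasurableSpace.prod
    rw [MeasurableSpace.comap_sup, MeasurableSpace.comap_comp, MeasurableSpace.comap_comp,
      MeasurableSpace.comap_comp]
    rfl
  rw [show MeasurableSet A ↔ MeasurableSet[inferInstance] A from Iff.rfl, hcm] at hA
  obtain ⟨A', hA', rfl⟩ := hA
  letI : MetricSpace (ℕ → Bool) := TopologicalSpace.metrizableSpaceMetric (ℕ → Bool)
  have han : AnalyticSet (Prod.fst '' A') :=
    (hA'.analyticSet (α := (ℕ → Bool) × X)).image_of_continuous continuous_fst
  haveI : IsProbabilityMeasure (P.map φ) := Measure.isProbabilityMeasure_map hφ.aemeasurable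
  have hn := analytic_nullMeasurable (P.map φ) han
  have := hn.preimage (hφ.quasiMeasurePreserving P)
  convert this using 1
  ext ω
  simp [φ]
end

section
open ProbabilityTheory
section join
variable {Z : Type*} {Γ : Z → Z} {Q : Set (Set Z)} {n : ℕ}

lemma iterJoin_name {s : Set Z} (hs : s ∈ iterJoin Γ Q n) :
    ∃ g : Fin n → Q, s = ⋂ i : Fin n, (Γ^[(i : ℕ)]) ⁻¹' (g i : Set Z) := by
  obtain ⟨f, hf, rfl⟩ := hs
  refine ⟨fun i => ⟨f i, hf i⟩, ?_⟩
  ext z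
  simp only [mem_iInter, mem_preimage, Finset.mem_range]
  exact ⟨fun h i => h i i.2, fun h i hi => h ⟨i, hi⟩⟩

lemma iterJoin_subset_range : iterJoin Γ Q n ⊆
    range (fun g : Fin n → Q => ⋂ i : Fin n, (Γ^[(i : ℕ)]) ⁻¹' (g i : Set Z)) := by
  intro s hs
  obtain ⟨g, rfl⟩ := iterJoin_name hs
  exact ⟨g, rfl⟩

lemma iterJoin_countable (hQ : Q.Countable) : (iterJoin Γ Q n).Countable := by
  have := hQ.to_subtype
  exact (countable_range _).mono iterJoin_subset_range

lemma iterJoin_finite (hQ : Q.Finite) : (iterJoin Γ Q n).Finite := by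
  have := hQ.to_subtype
  exact (finite_range _).subset iterJoin_subset_range

lemma iterJoin_measurable [MeasurableSpace Z] (hΓ : Measurable Γ) (hQ : ∀ q ∈ Q, MeasurableSet q) :
    ∀ s ∈ iterJoin Γ Q n, MeasurableSet s := by
  intro s hs
  obtain ⟨g, rfl⟩ := iterJoin_name hs
  exact MeasurableSet.iInter fun i => (hΓ.iterate i) (hQ _ (g i).2)

lemma iterJoin_eq (hQ : Q.PairwiseDisjoint id) {s t : Set Z} (hs : s ∈ iterJoin Γ Q n)
    (ht : t ∈ iterJoin Γ Q n) {z : Z} (hzs : z ∈ s) (hzt : z ∈ t) : s = t := by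
  obtain ⟨f, rfl⟩ := iterJoin_name hs
  obtain ⟨g, rfl⟩ := iterJoin_name ht
  congr! 3 with i
  exact hQ.elim_set (f i).2 (g i).2 _ (mem_iInter.1 hzs i) (mem_iInter.1 hzt i)

lemma iterJoin_cover {H : Set Z} (hH : MapsTo Γ H H) (hQ : H ⊆ ⋃₀ Q) {z : Z} (hz : z ∈ H) :
    ∃ s ∈ iterJoin Γ Q n, z ∈ s := by
  have : ∀ i : ℕ, ∃ q ∈ Q, Γ^[i] z ∈ q := fun i => hQ (hH.iterate i hz)
  choose f hf hz using this
  exact ⟨_, ⟨f, hf, rfl⟩, by simp only [mem_iInter]; exact fun i _ => hz i⟩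

lemma iterJoin_subset {H : Set Z} (hn : 0 < n) (hQ : ∀ q ∈ Q, q ⊆ H) :
    ∀ s ∈ iterJoin Γ Q n, s ⊆ H := by
  intro s hs z hz
  obtain ⟨g, rfl⟩ := iterJoin_name hs
  exact hQ _ (g ⟨0, hn⟩).2 (mem_iInter.1 hz ⟨0, hn⟩)

end join

section cover
variable {Ω W : Type*} {R A : Set (Set (Ω × W))}

lemma coverNum_spec (hR : R.Finite) {a : Set (Ω × W)} (ha : a ⊆ ⋃₀ R) (ω : Ω) :
    (∃ F : Finset (Set (Ω × W)), ↑F ⊆ R ∧ F.card ≤ coverNum a R ω ∧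
      fib a ω ⊆ ⋃ u ∈ F, fib u ω) ∧ coverNum a R ω ≤ max 1 hR.toFinset.card := by
  have hmem : hR.toFinset.card ∈ {n : ℕ | ∃ F : Finset (Set (Ω × W)), ↑F ⊆ R ∧ F.card = n ∧
    fib a ω ⊆ ⋃ u ∈ F, fib u ω} := by
    refine ⟨hR.toFinset, by simp, rfl, ?_⟩
    intro x hx
    obtain ⟨u, hu, hxu⟩ := ha hx
    simp only [mem_iUnion]
    exact ⟨u, by simpa using hu, hxu⟩
  constructor
  · obtain ⟨F, h1, h2, h3⟩ := Nat.sInf_mem ⟨_, hmem⟩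
    exact ⟨F, h1, h2.le.trans (le_max_right _ _), h3⟩
  · exact max_le_max le_rfl (Nat.sInf_le hmem)

lemma relCoverNum_spec (hR : R.Finite) (hA : ∀ a ∈ A, a ⊆ ⋃₀ R) (ω : Ω) :
    (∀ a ∈ A, ∃ F : Finset (Set (Ω × W)), ↑F ⊆ R ∧ F.card ≤ relCoverNum R A ω ∧
      fib a ω ⊆ ⋃ u ∈ F, fib u ω) ∧ relCoverNum R A ω ≤ max 1 hR.toFinset.card := by
  have hb : ∀ a, (⨆ (_ : a ∈ A), coverNum a R ω) ≤ max 1 hR.toFinset.card := by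
    intro a
    by_cases h : a ∈ A
    · rw [ciSup_pos h]
      exact (coverNum_spec hR (hA a h) ω).2
    · simp [h]
  constructor
  · intro a ha
    obtain ⟨F, h1, h2, h3⟩ := (coverNum_spec hR (hA a ha) ω).1
    refine ⟨F, h1, h2.trans ?_, h3⟩
    have := le_ciSup (f := fun a => ⨆ (_ : a ∈ A), coverNum a R ω)
      ⟨max 1 hR.toFinset.card, by rintro _ ⟨a, rfl⟩; exact hb a⟩ a
    rwa [ciSup_pos (f := fun _ : a ∈ A => coverNum a R ω) ha] at this
  · exact ciSup_le' hb

lemma coverNum_measurable {Ω X : Type*} [MeasurableSpace Ω]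
    [MeasurableSpace.CountablyGenerated Ω]
    [MetricSpace X] [CompactSpace X] [MeasurableSpace X] [BorelSpace X]
    (P : Measure Ω) [IsProbabilityMeasure P] (hP : P.IsComplete) {R : Set (Set (Ω × X))}
    (hR : R.Finite) (hRm : ∀ u ∈ R, MeasurableSet u) {a : Set (Ω × X)} (ha : MeasurableSet a) :
    Measurable (coverNum a R) := by
  classical
  have hfin : Finite {F : Finset (Set (Ω × X)) // ↑F ⊆ R} := by
    have : Finite {F : Finset (Set (Ω × X)) // F ∈ hR.toFinset.powerset} := inferInstance
    refine Finite.of_injective (fun F => (⟨F.1, ?_⟩ :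
      {F : Finset (Set (Ω × X)) // F ∈ hR.toFinset.powerset})) ?_
    · rw [Finset.mem_powerset]; intro u hu; simpa using F.2 hu
    · intro F G h; simpa [Subtype.ext_iff] using h
  let τ : Ω → ({F : Finset (Set (Ω × X)) // ↑F ⊆ R} → Prop) :=
    fun ω F => fib a ω ⊆ ⋃ u ∈ F.1, fib u ω
  have hτ : Measurable τ := by
    rw [measurable_pi_iff]
    intro F
    apply measurableSet_setOfPred.1
    have : MeasurableSet (a \ ⋃ u ∈ F.1, u) :=
      ha.diff (F.1.measurableSet_biUnion fun u hu => hRm u (F.2 hu))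
    have h2 := ((proj_nullMeasurable P this).measurable_of_complete).compl
    convert h2 using 1
    ext ω
    simp only [τ, mem_ofPred_eq, mem_compl_iff, mem_diff, mem_iUnion, not_exists, not_and, not_not]
    constructor
    · intro h x hx
      have := h hx
      simp only [mem_iUnion] at this
      exact fun h' => by
        obtain ⟨u, hu, hxu⟩ := this
        exact h' u hu hxu
    · intro h x hx
      have := h x hx
      push Not at this
      obtain ⟨u, hu, hxu⟩ := this
      simp only [mem_iUnion]
      exact ⟨u, hu, hxu⟩
  let g : ({F : Finset (Set (Ω × X)) // ↑F ⊆ R} → Prop) → ℕ := fun t =>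
    max 1 (sInf {n : ℕ | ∃ F, F.1.card = n ∧ t F})
  have hg : Measurable g := measurable_of_finite g
  convert hg.comp hτ using 1
  ext ω
  simp only [coverNum, g, τ, Function.comp]
  congr! 4 with n
  constructor
  · rintro ⟨F, h1, h2, h3⟩; exact ⟨⟨F, h1⟩, h2, h3⟩
  · rintro ⟨⟨F, h1⟩, h2, h3⟩; exact ⟨F, h1, h2, h3⟩

lemma relCoverNum_measurable {Ω X : Type*} [MeasurableSpace Ω]
    [MeasurableSpace.CountablyGenerated Ω]
    [MetricSpace X] [CompactSpace X] [MeasurableSpace X] [BorelSpace X]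
    (P : Measure Ω) [IsProbabilityMeasure P] (hP : P.IsComplete) {R A : Set (Set (Ω × X))}
    (hR : R.Finite) (hRm : ∀ u ∈ R, MeasurableSet u) (hA : A.Countable)
    (ha : ∀ a ∈ A, MeasurableSet a) :
    Measurable (relCoverNum R A) :=
  Measurable.biSup A hA fun a h => coverNum_measurable P hP hR hRm (ha a h)

end cover
end

section
open ProbabilityTheory
section approx
variable {Ω X Y : Type*} [MeasurableSpace Ω] [MeasurableSpace Y] [MeasurableSpace X]

/-- Measurable sets which only see finitely many measurable pieces of `X`. -/
def simpleClass (Ω X Y : Type*) [MeasurableSpace Ω] [MeasurableSpace Y] [MeasurableSpace X] :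
    Set (Set (Ω × Y × X)) :=
  {A | MeasurableSet A ∧ ∃ (J : Type) (_ : Finite J) (j : X → J) (C : Ω × Y → J → Prop),
    (∀ c, MeasurableSet (j ⁻¹' {c})) ∧ ∀ z, z ∈ A ↔ C (z.1, z.2.1) (j z.2.2)}

lemma simpleClass_algebra : IsSetAlgebra (simpleClass Ω X Y) where
  empty_mem := ⟨MeasurableSet.empty, Unit, inferInstance, fun _ => (), fun _ _ => False,
    fun c => by simp, by simp⟩
  compl_mem := by
    rintro s ⟨hs, J, hJ, j, C, hj, hC⟩
    exact ⟨hs.compl, J, hJ, j, fun b c => ¬ C b c, hj, fun z => by simp [hC]⟩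
  union_mem := by
    rintro s t ⟨hs, J, hJ, j, C, hj, hC⟩ ⟨ht, J', hJ', j', C', hj', hC'⟩
    refine ⟨hs.union ht, J × J', inferInstance, fun x => (j x, j' x),
      fun b c => C b c.1 ∨ C' b c.2, ?_, fun z => by simp [hC, hC']⟩
    rintro ⟨c, c'⟩
    convert (hj c).inter (hj' c') using 1
    ext x; simp

lemma simpleClass_gen : (inferInstance : MeasurableSpace (Ω × Y × X)) =
    MeasurableSpace.generateFrom (simpleClass Ω X Y) := by
  apply le_antisymm
  · have h1 : @Measurable _ _ (MeasurableSpace.generateFrom (simpleClass Ω X Y)) _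
        (fun z : Ω × Y × X => z.1) := by
      intro s hs
      apply MeasurableSpace.measurableSet_generateFrom
      exact ⟨measurable_fst hs, Unit, inferInstance, fun _ => (), fun b _ => b.1 ∈ s,
        fun c => by simp, fun z => Iff.rfl⟩
    have h2 : @Measurable _ _ (MeasurableSpace.generateFrom (simpleClass Ω X Y)) _
        (fun z : Ω × Y × X => z.2.1) := by
      intro s hs
      apply MeasurableSpace.measurableSet_generateFrom
      exact ⟨measurable_snd.fst hs, Unit, inferInstance, fun _ => (), fun b _ => b.2 ∈ s,
        fun c => by simp, fun z => Iff.rfl⟩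
    have h3 : @Measurable _ _ (MeasurableSpace.generateFrom (simpleClass Ω X Y)) _
        (fun z : Ω × Y × X => z.2.2) := by
      intro s hs
      apply MeasurableSpace.measurableSet_generateFrom
      refine ⟨measurable_snd.snd hs, Prop, inferInstance, fun x => x ∈ s, fun _ c => c,
        fun c => ?_, fun z => Iff.rfl⟩
      by_cases hc : c
      · convert hs using 1
        ext x; simp [hc]
      · convert hs.compl using 1
        ext x; simp [hc]
    have h4 := h1.prodMk (h2.prodMk h3)
    intro s hs
    exact h4 hs
  · exact MeasurableSpace.generateFrom_le fun s hs => hs.1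
end approx

lemma approx {Ω X Y : Type*} [MeasurableSpace Ω] [MeasurableSpace Y]
    [MetricSpace X] [CompactSpace X] [MeasurableSpace X] [BorelSpace X]
    (μ : Measure (Ω × Y × X)) [IsProbabilityMeasure μ] (R : Set (Set (Ω × Y × X)))
    (hRc : R.Countable) (hRm : ∀ r ∈ R, MeasurableSet r) (hRd : R.PairwiseDisjoint id)
    (hR1 : μ (⋃₀ R)ᶜ = 0) (ε : ℝ≥0∞) (hε : ε ≠ 0) :
    ∃ (J : Type) (_ : Finite J) (_ : Nonempty J) (K : J → Set X)
      (ρ : J → Ω × Y → Set (Ω × Y × X)) (B : Set (Ω × Y × X)),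
      (∀ c, IsClosed (K c)) ∧ (∀ c c', c ≠ c' → Disjoint (K c) (K c')) ∧ MeasurableSet B ∧
      μ B < ε ∧ ∀ z ∉ B, ∃ c, z.2.2 ∈ K c ∧ ∀ r ∈ R, z ∈ r → r = ρ c (z.1, z.2.1) := by
  classical
  have hne : R.Nonempty := by
    by_contra h
    rw [not_nonempty_iff_eq_empty] at h
    simp [h] at hR1
  have hXne : Nonempty X := by
    by_contra h
    have : IsEmpty (Ω × Y × X) := by
      rw [not_nonempty_iff] at h
      infer_instance
    have h1 : μ univ = 1 := measure_univ
    rw [univ_eq_empty_iff.2 this, measure_empty] at h1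
    exact zero_ne_one h1
  obtain ⟨f, rfl⟩ := hRc.exists_eq_range hne
  have hfm : ∀ i, MeasurableSet (f i) := fun i => hRm _ (mem_range_self i)
  have hε3 : ε / 3 ≠ 0 := ENNReal.div_ne_zero.2 ⟨hε, by simp⟩
  -- truncation
  obtain ⟨N, hN⟩ : ∃ N : ℕ, μ (⋂ i ∈ Finset.range N, (f i)ᶜ) < ε / 3 := by
    have hanti : Antitone fun N : ℕ => ⋂ i ∈ Finset.range N, (f i)ᶜ := by
      intro a b hab
      exact biInter_subset_biInter_left (by simpa using hab)
    have ht := tendsto_measure_iInter_atTop (μ := μ) (fun N : ℕ =>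
      (Finset.measurableSet_biInter (Finset.range N)
        fun i _ => (hfm i).compl).nullMeasurableSet) hanti ⟨0, measure_ne_top _ _⟩
    have h0 : μ (⋂ N : ℕ, ⋂ i ∈ Finset.range N, (f i)ᶜ) = 0 := by
      rw [← nonpos_iff_eq_zero, ← hR1]
      apply measure_mono
      intro z hz
      simp only [mem_iInter, Finset.mem_range] at hz
      simp only [sUnion_range, compl_iUnion, mem_iInter]
      exact fun i => hz (i+1) i (Nat.lt_succ_self i)
    rw [h0] at ht
    exact (ht.eventually (gt_mem_nhds (pos_iff_ne_zero.2 hε3))).exists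
  have hdense := Measure.MeasureDense.of_generateFrom_isSetAlgebra_finite μ
    (simpleClass_algebra (Ω := Ω) (X := X) (Y := Y)) simpleClass_gen
  obtain ⟨δ, hδ, hδs⟩ := ENNReal.exists_pos_sum_of_countable hε3 (Fin N)
  have h1 : ∀ l : Fin N, ∃ t ∈ simpleClass Ω X Y, μ (symmDiff (f l) t) < δ l := by
    intro l
    obtain ⟨t, ht, hlt⟩ := hdense.approx (f l) (hfm l) (measure_ne_top _ _) (δ l) (hδ l)
    exact ⟨t, ht, by simpa using hlt⟩
  choose t ht htδ using h1
  choose htm J hJ j C hj hC using ht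
  let A : (∀ l, J l) → Set X := fun c => ⋂ l, (j l) ⁻¹' {c l}
  have hA : ∀ c, MeasurableSet (A c) := fun c => MeasurableSet.iInter fun l => hj l _
  have hXm : Measurable fun z : Ω × Y × X => z.2.2 := by fun_prop
  let μX := μ.map fun z => z.2.2
  have : IsProbabilityMeasure μX := Measure.isProbabilityMeasure_map hXm.aemeasurable
  obtain ⟨η, hη, hηs⟩ := ENNReal.exists_pos_sum_of_countable hε3 (∀ l, J l)
  have h2 : ∀ c, ∃ F ⊆ A c, IsClosed F ∧ μX (A c \ F) < η c := fun c =>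
    (hA c).exists_isClosed_sdiff_lt (measure_ne_top _ _) (by simpa using (hη c).ne')
  choose K hKA hKc hKη using h2
  refine ⟨∀ l, J l, inferInstance, ⟨fun l => j l hXne.some⟩, K,
    fun c b => if h : ∃ l, C l b (c l) then f h.choose else ∅,
    (⋂ i ∈ Finset.range N, (f i)ᶜ) ∪ (⋃ l : Fin N, symmDiff (f l) (t l)) ∪
      ⋃ c, (fun z : Ω × Y × X => z.2.2) ⁻¹' (A c \ K c), hKc, ?_, ?_, ?_, ?_⟩
  · intro c c' hcc
    rw [Set.disjoint_left]
    intro x hx hx'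
    apply hcc
    funext l
    have e1 := mem_iInter.1 (hKA c hx) l
    have e2 := mem_iInter.1 (hKA c' hx') l
    simp only [mem_preimage, mem_singleton_iff] at e1 e2
    rw [← e1, ← e2]
  · refine ((Finset.measurableSet_biInter _ fun i _ => (hfm i).compl).union
      (MeasurableSet.iUnion fun l : Fin N => (hfm l).symmDiff (htm l))).union
      (MeasurableSet.iUnion fun c => hXm ((hA c).diff (hKc c).measurableSet))
  · calc _ ≤ μ (⋂ i ∈ Finset.range N, (f i)ᶜ) + μ (⋃ l : Fin N, symmDiff (f l) (t l)) +
          μ (⋃ c, (fun z : Ω × Y × X => z.2.2) ⁻¹' (A c \ K c)) :=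
          (measure_union_le _ _).trans (by gcongr; exact measure_union_le _ _)
      _ < ε / 3 + ε / 3 + ε / 3 := by
        refine ENNReal.add_lt_add (ENNReal.add_lt_add hN ?_) ?_
        · exact ((measure_iUnion_le _).trans (ENNReal.tsum_le_tsum fun l => (htδ l).le)).trans_lt hδs
        · refine ((measure_iUnion_le _).trans (ENNReal.tsum_le_tsum fun c => ?_)).trans_lt hηs
          have := (hKη c).le
          rwa [Measure.map_apply hXm ((hA c).diff (hKc c).measurableSet)] at this
      _ = ε := ENNReal.add_thirds ε
  · intro z hz
    simp only [mem_union, not_or, mem_iUnion, not_exists, mem_iInter, Finset.mem_range] at hz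
    obtain ⟨⟨hz1, hz2⟩, hz3⟩ := hz
    push Not at hz1
    obtain ⟨i, hiN, hi⟩ := hz1
    rw [mem_compl_iff, not_not] at hi
    have hz2' : ∀ l : Fin N, z ∈ f l ↔ C l (z.1, z.2.1) (j l z.2.2) := by
      intro l
      have := hz2 l
      rw [← hC l]
      simp only [mem_symmDiff] at this
      tauto
    refine ⟨fun l => j l z.2.2, ?_, ?_⟩
    · have := hz3 (fun l => j l z.2.2)
      by_contra hcon
      exact this ⟨mem_iInter.2 fun l => rfl, hcon⟩
    · intro r hr hzr
      have hex : ∃ l, C l (z.1, z.2.1) (j l z.2.2) := ⟨⟨i, hiN⟩, (hz2' ⟨i, hiN⟩).1 hi⟩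
      beta_reduce
      rw [dif_pos hex]
      exact hRd.elim_set hr (mem_range_self _) z hzr ((hz2' _).2 hex.choose_spec)
end

section
open ProbabilityTheory
section ker
variable {Ω X Y : Type*} [MeasurableSpace Ω] [MeasurableSpace Y] [MeasurableSpace X]

/-- conditional measure of a set on the fiber through `z`. -/
noncomputable def cm (κ : Kernel (Ω × Y) X) (A : Set (Ω × Y × X)) (z : Ω × Y × X) : ℝ≥0∞ :=
  κ (z.1, z.2.1) {x | (z.1, z.2.1, x) ∈ A}

lemma cm_measurable (κ : Kernel (Ω × Y) X) [IsMarkovKernel κ] {A : Set (Ω × Y × X)}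
    (hA : MeasurableSet A) : Measurable (cm κ A) := by
  have hm : Measurable fun p : (Ω × Y) × X => (p.1.1, p.1.2, p.2) := by fun_prop
  have h := Kernel.measurable_kernel_prodMk_left (κ := κ) (hm hA)
  have hm2 : Measurable fun z : Ω × Y × X => (z.1, z.2.1) := by fun_prop
  exact h.comp hm2

lemma cm_le_one (κ : Kernel (Ω × Y) X) [IsMarkovKernel κ] (A : Set (Ω × Y × X)) (z) :
    cm κ A z ≤ 1 := prob_le_one

lemma lint_measurable (κ : Kernel (Ω × Y) X) [IsMarkovKernel κ] {f : Ω × Y × X → ℝ≥0∞}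
    (hf : Measurable f) :
    Measurable fun z : Ω × Y × X => ∫⁻ x, f (z.1, z.2.1, x) ∂κ (z.1, z.2.1) := by
  have hm : Measurable fun p : (Ω × Y) × X => f (p.1.1, p.1.2, p.2) := by fun_prop
  have h := hm.lintegral_kernel_prod_right' (κ := κ)
  have hm2 : Measurable fun z : Ω × Y × X => (z.1, z.2.1) := by fun_prop
  exact h.comp hm2

variable [StandardBorelSpace X] [Nonempty X]

/-- The disintegration kernel. -/
noncomputable def kap (μ : Measure (Ω × Y × X)) [IsProbabilityMeasure μ] : Kernel (Ω × Y) X :=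
  condDistrib (fun z : Ω × Y × X => z.2.2) (fun z => (z.1, z.2.1)) μ

instance (μ : Measure (Ω × Y × X)) [IsProbabilityMeasure μ] : IsMarkovKernel (kap μ) := by
  unfold kap; infer_instance

lemma lint_kap (μ : Measure (Ω × Y × X)) [IsProbabilityMeasure μ] {f : Ω × Y × X → ℝ≥0∞}
    (hf : Measurable f) :
    ∫⁻ z, ∫⁻ x, f (z.1, z.2.1, x) ∂kap μ (z.1, z.2.1) ∂μ = ∫⁻ z, f z ∂μ := by
  have hm : Measurable fun p : (Ω × Y) × X => f (p.1.1, p.1.2, p.2) := by fun_prop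
  have hm2 : Measurable fun z : Ω × Y × X => (z.1, z.2.1) := by fun_prop
  have hm3 : Measurable fun z : Ω × Y × X => z.2.2 := by fun_prop
  have h1 := compProd_map_condDistrib (mβ := inferInstance) (μ := μ) (X := fun z : Ω × Y × X => (z.1, z.2.1))
    (Y := fun z : Ω × Y × X => z.2.2) hm3.aemeasurable
  have h2 := congrArg (fun m => ∫⁻ p, f (p.1.1, p.1.2, p.2) ∂m) h1
  rw [Measure.lintegral_compProd hm, lintegral_map hm.lintegral_kernel_prod_right' hm2,
    lintegral_map hm (hm2.prodMk hm3)] at h2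
  exact h2

lemma condExp_eq (μ : Measure (Ω × Y × X)) [IsProbabilityMeasure μ] {A : Set (Ω × Y × X)}
    (hA : MeasurableSet A) :
    μ[A.indicator (fun _ => (1 : ℝ)) | firstPairSigma Ω Y X] =ᵐ[μ]
      fun z => (cm (kap μ) A z).toReal := by
  have hm : Measurable fun p : (Ω × Y) × X => (p.1.1, p.1.2, p.2) := by fun_prop
  have hm2 : Measurable fun z : Ω × Y × X => (z.1, z.2.1) := by fun_prop
  have hm3 : Measurable fun z : Ω × Y × X => z.2.2 := by fun_prop
  have h := condExp_prod_ae_eq_integral_condDistrib (μ := μ)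
    (X := fun z : Ω × Y × X => (z.1, z.2.1)) (Y := fun z : Ω × Y × X => z.2.2)
    (f := fun p : (Ω × Y) × X => A.indicator (fun _ => (1 : ℝ)) (p.1.1, p.1.2, p.2)) hm2
    hm3.aemeasurable
    ((measurable_const.indicator hA).comp hm).stronglyMeasurable
    (by exact (integrable_const (1 : ℝ)).indicator hA)
  refine h.trans (Eventually.of_forall fun z => ?_)
  have hs : MeasurableSet {x | (z.1, z.2.1, x) ∈ A} := by
    have : Measurable fun x : X => (z.1, z.2.1, x) := by fun_prop
    exact this hA
  have := integral_indicator_const (μ := kap μ (z.1, z.2.1)) (1 : ℝ) hs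
  simp only [smul_eq_mul, mul_one] at this
  exact this

lemma partCondEntropy_eq (μ : Measure (Ω × Y × X)) [IsProbabilityMeasure μ]
    {R : Set (Set (Ω × Y × X))} (hR : ∀ r ∈ R, MeasurableSet r) :
    partCondEntropy (firstPairSigma Ω Y X) μ R =
      ∑' r : R, ∫⁻ z, cm (kap μ) r z * LL (cm (kap μ) r z) ∂μ := by
  unfold partCondEntropy
  congr 1; funext r
  have hm := cm_measurable (kap μ) (hR r r.2)
  have h1 : ∀ z, (cm (kap μ) r z).toReal ≤ 1 := fun z => by
    simpa using ENNReal.toReal_mono ENNReal.one_ne_top (cm_le_one (kap μ) r z)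
  have hae := condExp_eq μ (hR r r.2)
  have e1 : ∫ z, Real.negMulLog ((μ[(r : Set (Ω × Y × X)).indicator (fun _ => (1 : ℝ)) |
      firstPairSigma Ω Y X]) z) ∂μ = ∫ z, Real.negMulLog (cm (kap μ) r z).toReal ∂μ := by
    apply integral_congr_ae
    filter_upwards [hae] with z hz
    rw [hz]
  rw [e1, ofReal_integral_eq_lintegral_ofReal]
  · congr 1; funext z
    exact (mul_LL (cm_le_one _ _ _)).symm
  · have hmm : Measurable fun z => Real.negMulLog (cm (kap μ) r z).toReal :=
      Real.continuous_negMulLog.measurable.comp hm.ennreal_toReal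
    refine Integrable.of_bound hmm.aestronglyMeasurable 1 (Eventually.of_forall fun z => ?_)
    have h0 := Real.negMulLog_nonneg ENNReal.toReal_nonneg (h1 z)
    rw [Real.norm_of_nonneg h0]
    have := Real.negMulLog_le_one_sub_self (x := (cm (kap μ) r z).toReal) ENNReal.toReal_nonneg
    have h2 : 0 ≤ (cm (kap μ) r z).toReal := ENNReal.toReal_nonneg
    linarith
  · exact Eventually.of_forall fun z => Real.negMulLog_nonneg ENNReal.toReal_nonneg (h1 z)

end ker
end

section
open ProbabilityTheory
section core
variable {Ω X Y : Type*} [MeasurableSpace Ω] [MeasurableSpace Y] [MeasurableSpace X]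

lemma cm_sum (κ : Kernel (Ω × Y) X) [IsMarkovKernel κ] {A : Set (Set (Ω × Y × X))}
    (hAm : ∀ a ∈ A, MeasurableSet a)
    (hAd : ∀ a ∈ A, ∀ b ∈ A, ∀ z, z ∈ a → z ∈ b → a = b) (z : Ω × Y × X) :
    ∑' a : A, cm κ a z ≤ 1 := by
  have hs : Measurable fun x : X => (z.1, z.2.1, x) := by fun_prop
  have := tsum_measure_le_measure_univ (μ := κ (z.1, z.2.1))
    (s := fun a : A => {x | (z.1, z.2.1, x) ∈ (a : Set (Ω × Y × X))})
    (fun a => (hs (hAm a a.2)).nullMeasurableSet) (by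
      intro a b hab
      apply Disjoint.aedisjoint
      rw [Set.disjoint_left]
      intro x hx hx'
      exact hab (Subtype.ext (hAd a a.2 b b.2 _ hx hx')))
  rwa [measure_univ] at this

lemma core (κ : Kernel (Ω × Y) X) [IsMarkovKernel κ] {Γ : Ω × Y × X → Ω × Y × X}
    (hΓ : Measurable Γ) {H : Set (Ω × Y × X)} (hHm : MeasurableSet H) (hH : MapsTo Γ H H)
    {R Q : Set (Set (Ω × Y × X))} (hRc : R.Countable) (hRm : ∀ r ∈ R, MeasurableSet r)
    (hRd : R.PairwiseDisjoint id) (hRH : H ⊆ ⋃₀ R)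
    (hQc : Q.Countable) (hQm : ∀ r ∈ Q, MeasurableSet r)
    (hQd : Q.PairwiseDisjoint id) (hQH : H ⊆ ⋃₀ Q)
    (z0 : Ω × Y × X) (hz0 : cm κ H z0 = 1)
    (hbase : ∀ (i : ℕ) (x : X), (Γ^[i] (z0.1, z0.2.1, x)).1 = (Γ^[i] z0).1 ∧
      (Γ^[i] (z0.1, z0.2.1, x)).2.1 = (Γ^[i] z0).2.1)
    {J : Type} (V : J → Set X) (s : J → Ω × Y → Set (Ω × Y × X) → ℝ≥0∞)
    (hs : ∀ c b, ∑' r : R, s c b r ≤ 1)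
    (G : Ω × Y × X → ℝ≥0∞) (hGm : Measurable G)
    (hG : ∀ c z, z.2.2 ∈ V c → ∀ r ∈ R, z ∈ r → LL (s c (z.1, z.2.1) r) ≤ G z)
    (n N : ℕ)
    (hF : ∀ a ∈ iterJoin Γ Q n, ∃ F : Finset (Fin n → J), F.card ≤ N ∧
      ∀ x, (z0.1, z0.2.1, x) ∈ a → ∃ c ∈ F, ∀ i : Fin n,
        (Γ^[(i : ℕ)] (z0.1, z0.2.1, x)).2.2 ∈ V (c i)) :
    ∑' r : iterJoin Γ R n, cm κ r z0 * LL (cm κ r z0) ≤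
      ∑' a : iterJoin Γ Q n, cm κ a z0 * LL (cm κ a z0) + ENNReal.ofReal (Real.log N) +
      ∑ i : Fin n, ∫⁻ x, G (Γ^[(i : ℕ)] (z0.1, z0.2.1, x)) ∂κ (z0.1, z0.2.1) := by
  classical
  have hsec : Measurable fun x : X => (z0.1, z0.2.1, x) := by fun_prop
  set ν := κ (z0.1, z0.2.1) with hν
  choose! F hFN hFc using hF
  have hname : ∀ r : iterJoin Γ R n, ∃ g : Fin n → R,
      (r : Set (Ω × Y × X)) = ⋂ i : Fin n, (Γ^[(i : ℕ)]) ⁻¹' (g i : Set (Ω × Y × X)) :=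
    fun r => iterJoin_name r.2
  choose g hg using hname
  have hginj : Function.Injective g := by
    intro r r' h
    apply Subtype.ext
    rw [hg r, hg r', h]
  have : Countable (iterJoin Γ R n) := (iterJoin_countable hRc).to_subtype
  have : Countable (iterJoin Γ Q n) := (iterJoin_countable hQc).to_subtype
  have hRnm := iterJoin_measurable (n := n) hΓ hRm
  have hQnm := iterJoin_measurable (n := n) hΓ hQm
  let w : Set (Ω × Y × X) → (Fin n → J) → iterJoin Γ R n → ℝ≥0∞ := fun a c r =>
    ∏ i : Fin n, s (c i) ((Γ^[(i : ℕ)] z0).1, (Γ^[(i : ℕ)] z0).2.1) (g r i)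
  let q : iterJoin Γ R n → ℝ≥0∞ := fun r =>
    ∑' a : iterJoin Γ Q n, cm κ a z0 * ∑ c ∈ F a, (N : ℝ≥0∞)⁻¹ * w a c r
  have hw : ∀ a c, ∑' r, w a c r ≤ 1 := by
    intro a c
    refine (ENNReal.tsum_comp_le_tsum_of_injective hginj (fun h : Fin n → R => ∏ i : Fin n,
      s (c i) ((Γ^[(i : ℕ)] z0).1, (Γ^[(i : ℕ)] z0).2.1) (h i))).trans ?_
    exact tsum_pi_le_one n (fun i (r : R) =>
      s (c i) ((Γ^[(i : ℕ)] z0).1, (Γ^[(i : ℕ)] z0).2.1) r) (fun i => hs _ _)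
  have hq : ∑' r, q r ≤ 1 := by
    simp only [q]
    rw [ENNReal.tsum_comm]
    refine le_trans (ENNReal.tsum_le_tsum fun a => ?_)
      (cm_sum κ hQnm (fun a ha b hb z hza hzb => iterJoin_eq hQd ha hb hza hzb) z0)
    rw [ENNReal.tsum_mul_left]
    have : ∑' r, ∑ c ∈ F a, (N : ℝ≥0∞)⁻¹ * w a c r ≤ 1 := by
      rw [Summable.tsum_finsetSum (fun _ _ => ENNReal.summable)]
      calc ∑ c ∈ F a, ∑' r, (N : ℝ≥0∞)⁻¹ * w a c r ≤ ∑ c ∈ F a, (N : ℝ≥0∞)⁻¹ := by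
            refine Finset.sum_le_sum fun c _ => ?_
            rw [ENNReal.tsum_mul_left]
            exact mul_le_of_le_one_right' (hw a c)
        _ = (F a).card * (N : ℝ≥0∞)⁻¹ := by simp
        _ ≤ N * (N : ℝ≥0∞)⁻¹ := by
            gcongr
            exact hFN a a.2
        _ ≤ 1 := ENNReal.mul_inv_le_one _
    exact mul_le_of_le_one_right' this
  have hHae : ∀ᵐ x ∂ν, (z0.1, z0.2.1, x) ∈ H := by
    exact (prob_compl_eq_zero_iff (hsec hHm)).2 hz0
  have hp : ∑' r : iterJoin Γ R n, cm κ r z0 = 1 := by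
    refine le_antisymm (cm_sum κ hRnm
      (fun a ha b hb z hza hzb => iterJoin_eq hRd ha hb hza hzb) z0) ?_
    rw [← hz0]
    refine le_trans (measure_mono ?_) (measure_iUnion_le (μ := ν)
      (fun r : iterJoin Γ R n => {x | (z0.1, z0.2.1, x) ∈ (r : Set (Ω × Y × X))}))
    intro x hx
    obtain ⟨r, hr, hxr⟩ := iterJoin_cover (n := n) hH hRH hx
    exact mem_iUnion.2 ⟨⟨r, hr⟩, hxr⟩
  refine (gibbs _ q hp hq).trans ?_
  have hind : ∀ (A : Set (Ω × Y × X)) (c : ℝ≥0∞), MeasurableSet A → cm κ A z0 * c =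
      ∫⁻ x, A.indicator (fun _ => c) (z0.1, z0.2.1, x) ∂ν := by
    intro A c hA
    have : (fun x => A.indicator (fun _ => c) (z0.1, z0.2.1, x)) =
      ((fun x => (z0.1, z0.2.1, x)) ⁻¹' A).indicator (fun _ => c) := rfl
    rw [this, lintegral_indicator_const (hsec hA), mul_comm]
    rfl
  have e1 : ∑' r : iterJoin Γ R n, cm κ r z0 * LL (q r) =
      ∫⁻ x, ∑' r : iterJoin Γ R n,
        (r : Set (Ω × Y × X)).indicator (fun _ => LL (q r)) (z0.1, z0.2.1, x) ∂ν := by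
    rw [lintegral_tsum]
    · exact tsum_congr fun r => hind _ _ (hRnm r r.2)
    · intro r
      exact ((measurable_const.indicator (hRnm r r.2)).comp hsec).aemeasurable
  have e2 : ∑' a : iterJoin Γ Q n, cm κ a z0 * LL (cm κ a z0) =
      ∫⁻ x, ∑' a : iterJoin Γ Q n,
        (a : Set (Ω × Y × X)).indicator (fun _ => LL (cm κ a z0)) (z0.1, z0.2.1, x) ∂ν := by
    rw [lintegral_tsum]
    · exact tsum_congr fun r => hind _ _ (hQnm r r.2)
    · intro r
      exact ((measurable_const.indicator (hQnm r r.2)).comp hsec).aemeasurable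
  have e3 : ENNReal.ofReal (Real.log N) = ∫⁻ _, ENNReal.ofReal (Real.log N) ∂ν := by simp
  have hGm' : ∀ i : Fin n, Measurable fun x => G (Γ^[(i : ℕ)] (z0.1, z0.2.1, x)) := fun i =>
    hGm.comp ((hΓ.iterate i).comp hsec)
  rw [e1, e2, e3, ← lintegral_add_right _ measurable_const,
    ← lintegral_finsetSum _ (fun i _ => hGm' i),
    ← lintegral_add_right _ (Finset.measurable_fun_sum _ fun i _ => hGm' i)]
  apply lintegral_mono_ae
  filter_upwards [hHae] with x hx
  obtain ⟨r, hr, hxr⟩ := iterJoin_cover (n := n) hH hRH hx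
  obtain ⟨a, ha, hxa⟩ := iterJoin_cover (n := n) hH hQH hx
  rw [tsum_eq_single (⟨r, hr⟩ : iterJoin Γ R n) (by
    intro r' hne
    apply indicator_of_notMem
    intro hx'
    exact hne (Subtype.ext (iterJoin_eq hRd r'.2 hr hx' hxr)))]
  rw [tsum_eq_single (⟨a, ha⟩ : iterJoin Γ Q n) (by
    intro r' hne
    apply indicator_of_notMem
    intro hx'
    exact hne (Subtype.ext (iterJoin_eq hQd r'.2 ha hx' hxa)))]
  rw [indicator_of_mem hxr, indicator_of_mem hxa]
  obtain ⟨c, hcF, hc⟩ := hFc a ha x hxa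
  have hlow : cm κ a z0 * ((N : ℝ≥0∞)⁻¹ * w a c ⟨r, hr⟩) ≤ q ⟨r, hr⟩ := by
    refine le_trans ?_ (ENNReal.le_tsum (⟨a, ha⟩ : iterJoin Γ Q n))
    gcongr
    exact Finset.single_le_sum (f := fun c => (N : ℝ≥0∞)⁻¹ * w a c ⟨r, hr⟩)
      (fun _ _ => zero_le) hcF
  refine (LL_anti hlow).trans ?_
  refine (LL_mul _ _).trans ?_
  rw [add_assoc]
  gcongr
  refine (LL_mul _ _).trans ?_
  rw [LL_inv_nat]
  gcongr
  refine (LL_prod _ _).trans ?_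
  refine Finset.sum_le_sum fun i _ => ?_
  have hri : Γ^[(i : ℕ)] (z0.1, z0.2.1, x) ∈ (g ⟨r, hr⟩ i : Set (Ω × Y × X)) := by
    have h1 : (z0.1, z0.2.1, x) ∈ ((⟨r, hr⟩ : iterJoin Γ R n) : Set (Ω × Y × X)) := hxr
    rw [hg ⟨r, hr⟩] at h1
    exact mem_iInter.1 h1 i
  have := hG (c i) _ (hc i) _ (g ⟨r, hr⟩ i).2 hri
  rwa [(hbase i x).1, (hbase i x).2] at this

end core
end

section
open ProbabilityTheory
lemma exists_LL_small (ε : ℝ≥0∞) (hε : ε ≠ 0) : ∃ t δ : ℝ≥0∞, t + δ = 1 ∧ δ ≠ 0 ∧ LL t ≤ ε := by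
  have hm : min ε 1 ≠ ∞ := ne_top_of_le_ne_top ENNReal.one_ne_top (min_le_right _ _)
  have hm0 : min ε 1 ≠ 0 := by
    intro h
    rcases le_total ε 1 with h1 | h1
    · rw [min_eq_left h1] at h; exact hε h
    · rw [min_eq_right h1] at h; exact one_ne_zero h
  have he : 0 < (min ε 1).toReal := ENNReal.toReal_pos hm0 hm
  have hlt : ENNReal.ofReal (Real.exp (-(min ε 1).toReal)) < 1 := by
    rw [ENNReal.ofReal_lt_one]
    rw [← Real.exp_zero]
    exact Real.exp_lt_exp.2 (by linarith)
  refine ⟨ENNReal.ofReal (Real.exp (-(min ε 1).toReal)),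
    1 - ENNReal.ofReal (Real.exp (-(min ε 1).toReal)), add_tsub_cancel_of_le hlt.le,
    (tsub_pos_of_lt hlt).ne', ?_⟩
  have h0 : ENNReal.ofReal (Real.exp (-(min ε 1).toReal)) ≠ 0 := by
    simp [Real.exp_pos]
  rw [LL, if_neg h0, ENNReal.toReal_ofReal (Real.exp_pos _).le, Real.log_exp, neg_neg,
    ENNReal.ofReal_toReal hm]
  exact min_le_left _ _

lemma weights {Ω X Y : Type*} [MeasurableSpace Ω] [MeasurableSpace Y]
    [MetricSpace X] [CompactSpace X] [MeasurableSpace X] [BorelSpace X] [Nonempty X]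
    (μ : Measure (Ω × Y × X)) [IsProbabilityMeasure μ] (R : Set (Set (Ω × Y × X)))
    (hRc : R.Countable) (hRm : ∀ r ∈ R, MeasurableSet r) (hRd : R.PairwiseDisjoint id)
    (hR1 : μ (⋃₀ R)ᶜ = 0) (hRH : partCondEntropy (firstPairSigma Ω Y X) μ R ≠ ∞)
    (ε : ℝ≥0∞) (hε : ε ≠ 0) :
    ∃ (J : Type) (_ : Finite J) (V : J → Set X)
      (s : J → Ω × Y → Set (Ω × Y × X) → ℝ≥0∞) (G : Ω × Y × X → ℝ≥0∞),
      (∀ c, IsOpen (V c)) ∧ (∀ x, ∃ c, x ∈ V c) ∧ (∀ c b, ∑' r : R, s c b r ≤ 1) ∧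
      Measurable G ∧
      (∀ c z, z.2.2 ∈ V c → ∀ r ∈ R, z ∈ r → LL (s c (z.1, z.2.1) r) ≤ G z) ∧
      ∫⁻ z, G z ∂μ ≤ ε := by
  classical
  have : Countable R := hRc.to_subtype
  have hε2 : ε / 2 ≠ 0 := by simpa using hε
  obtain ⟨t, δ, htδ, hδ, ht⟩ := exists_LL_small (ε / 2) hε2
  let I : Ω × Y × X → ℝ≥0∞ := fun z =>
    ∑' r : R, (r : Set (Ω × Y × X)).indicator (fun z => LL (cm (kap μ) r z)) z
  have hLm : ∀ r : R, Measurable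
      ((r : Set (Ω × Y × X)).indicator (fun z => LL (cm (kap μ) r z))) := fun r =>
    (LL_measurable.comp (cm_measurable _ (hRm r r.2))).indicator (hRm r r.2)
  have hIm : Measurable I := Measurable.tsum hLm
  have hI : ∫⁻ z, I z ∂μ ≠ ∞ := by
    rw [partCondEntropy_eq μ hRm] at hRH
    convert hRH using 1
    simp only [I]
    rw [lintegral_tsum fun r => (hLm r).aemeasurable]
    refine tsum_congr fun r => ?_
    rw [← lint_kap μ (hLm r)]
    refine lintegral_congr fun z => ?_
    have hsec : Measurable fun x : X => (z.1, z.2.1, x) := by fun_prop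
    have : (fun x => (r : Set (Ω × Y × X)).indicator (fun z => LL (cm (kap μ) r z))
        (z.1, z.2.1, x)) =
      ((fun x => (z.1, z.2.1, x)) ⁻¹' (r : Set (Ω × Y × X))).indicator
        (fun _ => LL (cm (kap μ) r z)) := rfl
    rw [this, lintegral_indicator_const (hsec (hRm r r.2)), mul_comm]
    rfl
  have hI2 : ∫⁻ z, (LL δ + I z) ∂μ ≠ ∞ := by
    rw [lintegral_add_left measurable_const]
    simp [LL_ne_top hδ, hI]
  obtain ⟨η, hη, hη2⟩ := exists_pos_setLIntegral_lt_of_measure_lt hI2 hε2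
  obtain ⟨J, hJ, hJn, K, ρ, B, hK, hKd, hBm, hB, hρ⟩ :=
    approx μ R hRc hRm hRd hR1 η hη.ne'
  refine ⟨J, hJ, fun c => (⋃ c' ∈ {c' | c' ≠ c}, K c')ᶜ,
    fun c b r => t * (if r = ρ c b then 1 else 0) + δ * kap μ b {x | (b.1, b.2, x) ∈ r},
    fun z => LL t + B.indicator (fun z => LL δ + I z) z, ?_, ?_, ?_, ?_, ?_, ?_⟩
  · intro c
    rw [isOpen_compl_iff]
    exact (Set.toFinite _).isClosed_biUnion fun c' _ => hK c'
  · intro x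
    by_cases h : ∃ c, x ∈ K c
    · obtain ⟨c, hc⟩ := h
      refine ⟨c, ?_⟩
      simp only [mem_compl_iff, mem_iUnion, not_exists]
      intro c' hc' hx
      exact Set.disjoint_left.1 (hKd c' c hc') hx hc
    · push Not at h
      obtain ⟨c⟩ := hJn
      refine ⟨c, ?_⟩
      simp only [mem_compl_iff, mem_iUnion, not_exists]
      intro c' hc' hx
      exact h c' hx
  · intro c b
    rw [ENNReal.tsum_add, ENNReal.tsum_mul_left, ENNReal.tsum_mul_left]
    have h1 : ∑' r : R, (if (r : Set (Ω × Y × X)) = ρ c b then (1 : ℝ≥0∞) else 0) ≤ 1 := by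
      refine (ENNReal.tsum_comp_le_tsum_of_injective Subtype.val_injective
        (fun r : Set (Ω × Y × X) => if r = ρ c b then (1 : ℝ≥0∞) else 0)).trans ?_
      rw [tsum_ite_eq]
    have h2 : ∑' r : R, kap μ b {x | (b.1, b.2, x) ∈ (r : Set (Ω × Y × X))} ≤ 1 := by
      obtain ⟨x0⟩ := ‹Nonempty X›
      exact cm_sum (kap μ) hRm (fun a ha a' ha' z hz hz' =>
        hRd.elim_set ha ha' z hz hz') (b.1, b.2, x0)
    exact (add_le_add (mul_le_of_le_one_right' h1) (mul_le_of_le_one_right' h2)).trans htδ.le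
  · exact measurable_const.add ((measurable_const.add hIm).indicator hBm)
  · intro c z hz r hr hzr
    by_cases hzB : z ∈ B
    · have h1 : LL (t * (if r = ρ c (z.1, z.2.1) then 1 else 0) +
          δ * kap μ (z.1, z.2.1) {x | (z.1, z.2.1, x) ∈ r}) ≤ LL (δ * cm (kap μ) r z) :=
        LL_anti le_add_self
      refine h1.trans ((LL_mul _ _).trans ?_)
      refine le_trans ?_ le_add_self
      rw [indicator_of_mem hzB]
      gcongr
      refine le_trans ?_ (ENNReal.le_tsum (⟨r, hr⟩ : R))
      rw [indicator_of_mem (show z ∈ ((⟨r, hr⟩ : R) : Set (Ω × Y × X)) from hzr)]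
    · obtain ⟨c', hc', hc2⟩ := hρ z hzB
      have : c' = c := by
        by_contra h
        apply hz
        simp only [mem_iUnion]
        exact ⟨c', h, hc'⟩
      subst this
      refine le_trans (LL_anti ?_) le_self_add
      beta_reduce
      rw [if_pos (hc2 r hr hzr), mul_one]
      exact le_self_add
  · rw [lintegral_add_left measurable_const, lintegral_indicator hBm]
    simp only [lintegral_const, measure_univ, mul_one]
    calc LL t + ∫⁻ z in B, (LL δ + I z) ∂μ ≤ ε / 2 + ε / 2 := add_le_add ht (hη2 B hB).le
      _ = ε := ENNReal.add_halves ε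

lemma limsup_le_aux (a b c : ℕ → ℝ≥0∞) (ε : ℝ≥0∞)
    (h : ∀ n, 0 < n → a n ≤ b n + c n + ε) :
    limsup a atTop ≤ limsup b atTop + limsup c atTop + ε := by
  refine ENNReal.le_of_forall_pos_le_add fun δ hδ hfin => ?_
  have hb : limsup b atTop ≠ ∞ := by
    intro h; rw [h] at hfin; simp at hfin
  have hc : limsup c atTop ≠ ∞ := by
    intro h; rw [h] at hfin; simp at hfin
  have hδ2 : (δ : ℝ≥0∞) / 2 ≠ 0 := by simpa using hδ.ne'
  have e1 := eventually_lt_of_limsup_lt (ENNReal.lt_add_right hb hδ2)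
  have e2 := eventually_lt_of_limsup_lt (ENNReal.lt_add_right hc hδ2)
  refine limsup_le_of_le (by isBoundedDefault) ?_
  filter_upwards [e1, e2, eventually_gt_atTop 0] with n h1 h2 h3
  calc a n ≤ b n + c n + ε := h n h3
    _ ≤ (limsup b atTop + δ / 2) + (limsup c atTop + δ / 2) + ε := by gcongr
    _ = limsup b atTop + limsup c atTop + ε + (δ / 2 + δ / 2) := by ring
    _ = _ := by rw [ENNReal.add_halves]
end

section
open ProbabilityTheory
/-- fiber product of bundles -/
def HH {Ω X Y : Type*} (G : Set (Ω × Y)) (E : Set (Ω × X)) : Set (Ω × Y × X) :=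
  {p | p.2.1 ∈ fib G p.1 ∧ p.2.2 ∈ fib E p.1}

/-- product skew product -/
def GG {Ω X Y : Type*} (ϑ : Ω → Ω) (S : Ω → Y → Y) (T : Ω → X → X) :
    Ω × Y × X → Ω × Y × X := fun p => (ϑ p.1, S p.1 p.2.1, T p.1 p.2.2)

/-- pulled back partition -/
def PQ {Ω X Y : Type*} (G : Set (Ω × Y)) (E : Set (Ω × X)) (Q : Set (Set (Ω × X))) :
    Set (Set (Ω × Y × X)) :=
  {s | ∃ q ∈ Q, s = (fun p : Ω × Y × X => (p.1, p.2.2)) ⁻¹' q ∩ HH G E}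

section fin
variable {Ω X Y : Type*} {ϑ : Ω → Ω} {S : Ω → Y → Y} {T : Ω → X → X}

lemma GG_iter_X (i : ℕ) (z : Ω × Y × X) :
    ((GG ϑ S T)^[i] z).1 = ((skew ϑ T)^[i] (z.1, z.2.2)).1 ∧
    ((GG ϑ S T)^[i] z).2.2 = ((skew ϑ T)^[i] (z.1, z.2.2)).2 := by
  have h : Function.Semiconj (fun z : Ω × Y × X => (z.1, z.2.2)) (GG ϑ S T) (skew ϑ T) :=
    fun z => rfl
  have := (h.iterate_right i) z
  exact ⟨congrArg Prod.fst this, congrArg Prod.snd this⟩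

lemma GG_iter_Y (i : ℕ) (z : Ω × Y × X) :
    ((GG ϑ S T)^[i] z).1 = ((skew ϑ S)^[i] (z.1, z.2.1)).1 ∧
    ((GG ϑ S T)^[i] z).2.1 = ((skew ϑ S)^[i] (z.1, z.2.1)).2 := by
  have h : Function.Semiconj (fun z : Ω × Y × X => (z.1, z.2.1)) (GG ϑ S T) (skew ϑ S) :=
    fun z => rfl
  have := (h.iterate_right i) z
  exact ⟨congrArg Prod.fst this, congrArg Prod.snd this⟩

lemma cover_names {G : Set (Ω × Y)} {E : Set (Ω × X)} {Q : Set (Set (Ω × X))}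
    (hmaps : MapsTo (skew ϑ T) E E) (hQE : ∀ q ∈ Q, q ⊆ E)
    {J : Type} [Finite J] [Nonempty X] (V : J → Set X) (hV : ∀ x, ∃ c, x ∈ V c) {n : ℕ} (hn : 0 < n)
    (ω : Ω) (y : Y) (a : Set (Ω × Y × X)) (ha : a ∈ iterJoin (GG ϑ S T) (PQ G E Q) n) :
    ∃ F : Finset (Fin n → J), F.card ≤ relCoverNum
        (iterJoin (skew ϑ T) (range fun c => (univ ×ˢ V c) ∩ E) n) (iterJoin (skew ϑ T) Q n) ω ∧
      ∀ x, (ω, y, x) ∈ a → ∃ c ∈ F, ∀ i : Fin n,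
        ((GG ϑ S T)^[(i : ℕ)] (ω, y, x)).2.2 ∈ V (c i) := by
  classical
  obtain ⟨f, hf, rfl⟩ := ha
  choose q hq hfq using hf
  have hU : E ⊆ ⋃₀ (range fun c => ((univ : Set Ω) ×ˢ V c) ∩ E) := by
    intro p hp
    obtain ⟨c, hc⟩ := hV p.2
    exact ⟨_, ⟨c, rfl⟩, ⟨⟨mem_univ _, hc⟩, hp⟩⟩
  have hcov : ∀ b ∈ iterJoin (skew ϑ T) Q n,
      b ⊆ ⋃₀ (iterJoin (skew ϑ T) (range fun c => (univ ×ˢ V c) ∩ E) n) := by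
    intro b hb p hp
    obtain ⟨s, hs, hps⟩ := iterJoin_cover (n := n) hmaps hU (iterJoin_subset hn hQE b hb hp)
    exact ⟨s, hs, hps⟩
  obtain ⟨F0, hF1, hF2, hF3⟩ := (relCoverNum_spec (iterJoin_finite (finite_range _)) hcov ω).1
    (⋂ i ∈ Finset.range n, ((skew ϑ T)^[i]) ⁻¹' (q i)) ⟨q, hq, rfl⟩
  have hname : ∀ u : Set (Ω × X), ∃ c : ℕ → J,
      u ∈ iterJoin (skew ϑ T) (range fun c => (univ ×ˢ V c) ∩ E) n → ∀ p ∈ u, ∀ i : Fin n,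
        ((skew ϑ T)^[(i : ℕ)] p).2 ∈ V (c i) := by
    intro u
    by_cases hu : u ∈ iterJoin (skew ϑ T) (range fun c => (univ ×ˢ V c) ∩ E) n
    · obtain ⟨g, hg, rfl⟩ := hu
      choose c hc using hg
      refine ⟨c, fun _ p hp i => ?_⟩
      have h1 := mem_iInter₂.1 hp i (Finset.mem_range.2 i.2)
      rw [mem_preimage, ← hc i] at h1
      exact h1.1.2
    · have hne : Nonempty (ℕ → J) := by
        obtain ⟨x⟩ := ‹Nonempty X›
        exact ⟨fun _ => (hV x).choose⟩
      exact ⟨hne.some, fun h => absurd h hu⟩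
  choose cc hcc using hname
  refine ⟨F0.image fun u i => cc u i, Finset.card_image_le.trans hF2, ?_⟩
  intro x hx
  have hx' : x ∈ fib (⋂ i ∈ Finset.range n, ((skew ϑ T)^[i]) ⁻¹' (q i)) ω := by
    refine mem_iInter₂.2 fun i hi => ?_
    have h1 := mem_iInter₂.1 hx i hi
    rw [mem_preimage, hfq i] at h1
    have h2 := h1.1
    have h3 := GG_iter_X (ϑ := ϑ) (S := S) (T := T) i (ω, y, x)
    rw [mem_preimage, h3.1, h3.2] at h2
    exact h2
  obtain ⟨u, hu, hxu⟩ := mem_iUnion₂.1 (hF3 hx')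
  refine ⟨_, Finset.mem_image_of_mem _ hu, fun i => ?_⟩
  rw [(GG_iter_X (i : ℕ) (ω, y, x)).2]
  exact hcc u (hF1 hu) (ω, x) hxu i

end fin
end

section
open ProbabilityTheory
lemma ae_cm_one {Ω X Y : Type*} [MeasurableSpace Ω] [MeasurableSpace Y]
    [MeasurableSpace X] [StandardBorelSpace X] [Nonempty X]
    (μ : Measure (Ω × Y × X)) [IsProbabilityMeasure μ] {H : Set (Ω × Y × X)}
    (hHm : MeasurableSet H) (hH : μ H = 1) : ∀ᵐ z ∂μ, cm (kap μ) H z = 1 := by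
  have hm : Measurable (Hᶜ.indicator (fun _ : Ω × Y × X => (1 : ℝ≥0∞))) :=
    measurable_const.indicator hHm.compl
  have h := lint_kap μ hm
  rw [lintegral_indicator_const hHm.compl, (prob_compl_eq_zero_iff hHm).2 hH, mul_zero,
    lintegral_eq_zero_iff (lint_measurable (kap μ) hm)] at h
  filter_upwards [h] with z hz
  have hsec : Measurable fun x : X => (z.1, z.2.1, x) := by fun_prop
  have e : (fun x => Hᶜ.indicator (fun _ : Ω × Y × X => (1 : ℝ≥0∞)) (z.1, z.2.1, x)) =
    (((fun x => (z.1, z.2.1, x)) ⁻¹' H)ᶜ).indicator (fun _ => 1) := rfl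
  rw [e, lintegral_indicator_const (hsec hHm).compl, one_mul] at hz
  exact (prob_compl_eq_zero_iff (hsec hHm)).1 hz

lemma step {Ω X Y : Type*} [MeasurableSpace Ω] [MeasurableSpace.CountablyGenerated Ω]
    [MetricSpace X] [CompactSpace X] [MeasurableSpace X] [BorelSpace X] [Nonempty X]
    [MeasurableSpace Y]
    (P : Measure Ω) [IsProbabilityMeasure P] (hP : P.IsComplete)
    {ϑ : Ω → Ω} {E : Set (Ω × X)} (hE : MeasurableSet E)
    {G : Set (Ω × Y)} {T : Ω → X → X} {S : Ω → Y → Y}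
    (hTm : Measurable (skew ϑ T)) (hmaps : MapsTo (skew ϑ T) E E)
    (hΓ : Measurable (GG ϑ S T)) (hHm : MeasurableSet (HH G E))
    (hH : MapsTo (GG ϑ S T) (HH G E) (HH G E))
    (μ : Measure (Ω × Y × X)) [IsProbabilityMeasure μ] (hμP : μ.map Prod.fst = P)
    (hμH : μ (HH G E) = 1) (hμΓ : μ.map (GG ϑ S T) = μ)
    {Q : Set (Set (Ω × X))} (hQf : Q.Finite) (hQ : IsCountablePartition E Q)
    (hPQm : ∀ s ∈ PQ G E Q, MeasurableSet s) (hPQf : (PQ G E Q).Finite)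
    (hPQd : (PQ G E Q).PairwiseDisjoint id) (hPQH : HH G E ⊆ ⋃₀ PQ G E Q)
    {R : Set (Set (Ω × Y × X))} (hRc : R.Countable) (hRm : ∀ r ∈ R, MeasurableSet r)
    (hRd : R.PairwiseDisjoint id) (hRH : HH G E ⊆ ⋃₀ R)
    {J : Type} [Finite J] (V : J → Set X) (hVo : ∀ c, IsOpen (V c)) (hV : ∀ x, ∃ c, x ∈ V c)
    (s : J → Ω × Y → Set (Ω × Y × X) → ℝ≥0∞)
    (hs : ∀ c b, ∑' r : R, s c b r ≤ 1)
    (g : Ω × Y × X → ℝ≥0∞) (hgm : Measurable g)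
    (hg : ∀ c z, z.2.2 ∈ V c → ∀ r ∈ R, z ∈ r → LL (s c (z.1, z.2.1) r) ≤ g z)
    (n : ℕ) (hn : 0 < n) :
    partCondEntropy (firstPairSigma Ω Y X) μ (iterJoin (GG ϑ S T) R n) ≤
      partCondEntropy (firstPairSigma Ω Y X) μ (iterJoin (GG ϑ S T) (PQ G E Q) n) +
      ENNReal.ofReal (∫ ω, iterCoverLog (skew ϑ T)
        (range fun c => (univ ×ˢ V c) ∩ E) Q n ω ∂P) + n * ∫⁻ z, g z ∂μ := by
  have hUm : ∀ u ∈ (range fun c => ((univ : Set Ω) ×ˢ V c) ∩ E), MeasurableSet u := by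
    rintro _ ⟨c, rfl⟩
    exact (MeasurableSet.univ.prod (hVo c).measurableSet).inter hE
  have hRnm := iterJoin_measurable (n := n) hΓ hRm
  have hQnm := iterJoin_measurable (n := n) hΓ hPQm
  have : Countable (iterJoin (GG ϑ S T) R n) := (iterJoin_countable hRc).to_subtype
  have : Countable (iterJoin (GG ϑ S T) (PQ G E Q) n) :=
    (iterJoin_countable hPQf.countable).to_subtype
  have hmeas : ∀ A : Set (Ω × Y × X), MeasurableSet A →
      Measurable fun z => cm (kap μ) A z * LL (cm (kap μ) A z) := fun A hA =>
    (cm_measurable _ hA).mul (LL_measurable.comp (cm_measurable _ hA))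
  rw [partCondEntropy_eq μ hRnm, partCondEntropy_eq μ hQnm,
    ← lintegral_tsum fun r : iterJoin (GG ϑ S T) R n => (hmeas _ (hRnm r r.2)).aemeasurable,
    ← lintegral_tsum fun r : iterJoin (GG ϑ S T) (PQ G E Q) n => (hmeas _ (hQnm r r.2)).aemeasurable]
  have hUf := iterJoin_finite (Γ := skew ϑ T) (n := n)
    (finite_range fun c => ((univ : Set Ω) ×ˢ V c) ∩ E)
  have hNm : Measurable (relCoverNum
      (iterJoin (skew ϑ T) (range fun c => (univ ×ˢ V c) ∩ E) n) (iterJoin (skew ϑ T) Q n)) :=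
    relCoverNum_measurable P hP hUf (iterJoin_measurable hTm hUm)
      (iterJoin_countable hQ.1) (iterJoin_measurable hTm hQ.2.1)
  set N := relCoverNum
      (iterJoin (skew ϑ T) (range fun c => (univ ×ˢ V c) ∩ E) n) (iterJoin (skew ϑ T) Q n) with hN
  have hlogm : Measurable fun ω => Real.log (N ω) :=
    Real.measurable_log.comp (measurable_from_nat.comp hNm)
  have hU : E ⊆ ⋃₀ (range fun c => ((univ : Set Ω) ×ˢ V c) ∩ E) := by
    intro p hp
    obtain ⟨c, hc⟩ := hV p.2
    exact ⟨_, ⟨c, rfl⟩, ⟨⟨mem_univ _, hc⟩, hp⟩⟩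
  have hcov : ∀ b ∈ iterJoin (skew ϑ T) Q n,
      b ⊆ ⋃₀ (iterJoin (skew ϑ T) (range fun c => (univ ×ˢ V c) ∩ E) n) := by
    intro b hb p hp
    obtain ⟨s, hs, hps⟩ := iterJoin_cover (n := n) hmaps hU
      (iterJoin_subset hn hQ.2.2.1 b hb hp)
    exact ⟨s, hs, hps⟩
  have hlog : ENNReal.ofReal (∫ ω, iterCoverLog (skew ϑ T)
        (range fun c => (univ ×ˢ V c) ∩ E) Q n ω ∂P) =
      ∫⁻ z, ENNReal.ofReal (Real.log (N z.1)) ∂μ := by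
    have e1 : ∫⁻ z : Ω × Y × X, ENNReal.ofReal (Real.log (N z.1)) ∂μ =
        ∫⁻ ω, ENNReal.ofReal (Real.log (N ω)) ∂P := by
      rw [← hμP, lintegral_map hlogm.ennreal_ofReal measurable_fst]
    rw [e1]
    refine ofReal_integral_eq_lintegral_ofReal ?_ (Eventually.of_forall fun ω =>
      Real.log_natCast_nonneg _)
    refine Integrable.of_bound hlogm.aestronglyMeasurable
      (Real.log (max 1 hUf.toFinset.card : ℕ)) (Eventually.of_forall fun ω => ?_)
    change ‖Real.log (N ω)‖ ≤ _
    rw [Real.norm_of_nonneg (Real.log_natCast_nonneg _)]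
    rcases Nat.eq_zero_or_pos (N ω) with h0 | h0
    · rw [h0]
      simpa using Real.log_natCast_nonneg (max 1 hUf.toFinset.card)
    · refine Real.log_le_log (by exact_mod_cast h0) ?_
      exact_mod_cast (relCoverNum_spec hUf hcov ω).2
  have hint : n * ∫⁻ z, g z ∂μ = ∫⁻ z, ∑ i : Fin n,
      ∫⁻ x, g ((GG ϑ S T)^[(i : ℕ)] (z.1, z.2.1, x)) ∂kap μ (z.1, z.2.1) ∂μ := by
    have hgi : ∀ i : Fin n, Measurable fun z => g ((GG ϑ S T)^[(i : ℕ)] z) := fun i =>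
      hgm.comp (hΓ.iterate i)
    rw [lintegral_finsetSum _ fun i _ => lint_measurable (kap μ) (hgi i)]
    have hmp : MeasurePreserving (GG ϑ S T) μ μ := ⟨hΓ, hμΓ⟩
    rw [Finset.sum_congr rfl fun i _ => (lint_kap μ (hgi i)).trans
      ((hmp.iterate i).lintegral_comp hgm)]
    simp
  have hsum : Measurable fun z : Ω × Y × X => ∑ i : Fin n,
      ∫⁻ x, g ((GG ϑ S T)^[(i : ℕ)] (z.1, z.2.1, x)) ∂kap μ (z.1, z.2.1) :=
    Finset.measurable_fun_sum _ fun i _ =>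
      lint_measurable (kap μ) (hgm.comp (hΓ.iterate i))
  rw [hlog, hint, ← lintegral_add_left
    (Measurable.tsum fun r : iterJoin (GG ϑ S T) (PQ G E Q) n => hmeas _ (hQnm r r.2)),
    ← lintegral_add_right _ hsum]
  apply lintegral_mono_ae
  filter_upwards [ae_cm_one μ hHm hμH] with z0 hz0
  refine core (kap μ) hΓ hHm hH hRc hRm hRd hRH hPQf.countable hPQm hPQd hPQH z0 hz0 ?_
    V s hs g hgm hg n (N z0.1) ?_
  · intro i x
    have h1 := GG_iter_Y (ϑ := ϑ) (S := S) (T := T) i (z0.1, z0.2.1, x)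
    have h2 := GG_iter_Y (ϑ := ϑ) (S := S) (T := T) i z0
    exact ⟨h1.1.trans h2.1.symm, h1.2.trans h2.2.symm⟩
  · intro a ha
    exact cover_names hmaps hQ.2.2.1 V hV hn z0.1 z0.2.1 a ha

lemma final {Ω X Y : Type*} [MeasurableSpace Ω] [MeasurableSpace.CountablyGenerated Ω]
    [MetricSpace X] [CompactSpace X] [MeasurableSpace X] [BorelSpace X]
    [MetricSpace Y] [MeasurableSpace Y]
    (P : Measure Ω) [IsProbabilityMeasure P] (hP : P.IsComplete)
    (ϑ : Ω → Ω) (E : Set (Ω × X)) (hE : MeasurableSet E)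
    (G : Set (Ω × Y)) (hG : MeasurableSet G)
    (T : Ω → X → X) (hT : IsBundleRDS P ϑ E T)
    (S : Ω → Y → Y) (hS : IsBundleRDS P ϑ G S)
    (μ : Measure (Ω × Y × X)) [IsProbabilityMeasure μ] (hμP : μ.map Prod.fst = P)
    (hμH : μ (HH G E) = 1) (hμΓ : μ.map (GG ϑ S T) = μ)
    (Q : Set (Set (Ω × X))) (hQf : Q.Finite) (hQ : IsCountablePartition E Q) :
    relEnt (firstPairSigma Ω Y X) μ (GG ϑ S T) (HH G E) ≤
      relEntPart (firstPairSigma Ω Y X) μ (GG ϑ S T) (PQ G E Q) +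
          condTailEnt P E (skew ϑ T) Q := by
  have hXne : Nonempty X := by
    by_contra h
    have : (HH G E) = ∅ := eq_empty_of_forall_notMem fun z _ => h ⟨z.2.2⟩
    rw [this] at hμH
    simp at hμH
  have hϑ := hT.measurePreserving.measurable
  have hTm0 := hT.measurable
  have hSm0 := hS.measurable
  have hTm : Measurable (skew ϑ T) := (hϑ.comp measurable_fst).prodMk hTm0
  have hpX : Measurable fun p : Ω × Y × X => (p.1, p.2.2) := by fun_prop
  have hpY : Measurable fun p : Ω × Y × X => (p.1, p.2.1) := by fun_prop
  have hΓ : Measurable (GG ϑ S T) :=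
    (hϑ.comp measurable_fst).prodMk ((hSm0.comp hpY).prodMk (hTm0.comp hpX))
  have hHm : MeasurableSet (HH G E) := (hpY hG).inter (hpX hE)
  have hmaps : MapsTo (skew ϑ T) E E := fun p hp => hT.mapsTo p.1 hp
  have hH : MapsTo (GG ϑ S T) (HH G E) (HH G E) := fun p hp =>
    ⟨hS.mapsTo p.1 hp.1, hT.mapsTo p.1 hp.2⟩
  have hPQm : ∀ s ∈ PQ G E Q, MeasurableSet s := by
    rintro _ ⟨q, hq, rfl⟩
    exact (hpX (hQ.2.1 q hq)).inter hHm
  have hPQf : (PQ G E Q).Finite := by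
    refine (hQf.image fun q => (fun p : Ω × Y × X => (p.1, p.2.2)) ⁻¹' q ∩ HH G E).subset ?_
    rintro _ ⟨q, hq, rfl⟩
    exact ⟨q, hq, rfl⟩
  have hPQd : (PQ G E Q).PairwiseDisjoint id := by
    rintro _ ⟨q, hq, rfl⟩ _ ⟨q', hq', rfl⟩ hne
    refine Set.disjoint_left.2 fun z hz hz' => hne ?_
    rw [hQ.2.2.2.1.elim_set hq hq' _ hz.1 hz'.1]
  have hPQH : HH G E ⊆ ⋃₀ PQ G E Q := by
    intro z hz
    have h1 : (z.1, z.2.2) ∈ ⋃₀ Q := by rw [hQ.2.2.2.2]; exact hz.2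
    obtain ⟨q, hq, hzq⟩ := h1
    exact ⟨_, ⟨q, hq, rfl⟩, hzq, hz⟩
  unfold relEnt
  refine iSup₂_le fun R hR => ?_
  obtain ⟨⟨hRc, hRm, hRE, hRd, hRU⟩, hRfin⟩ := hR
  refine ENNReal.le_of_forall_pos_le_add fun ε hε _ => ?_
  obtain ⟨J, hJ, V, s, g, hVo, hV, hs, hgm, hg, hgε⟩ := weights μ R hRc hRm hRd
    (by rw [hRU]; exact (prob_compl_eq_zero_iff hHm).2 hμH) hRfin ε (by exact_mod_cast hε.ne')
  have hopen : IsOpenRandomCover P E (range fun c => ((univ : Set Ω) ×ˢ V c) ∩ E) := by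
    refine ⟨⟨(finite_range _).countable, ?_, ?_, ?_⟩, ?_⟩
    · rintro _ ⟨c, rfl⟩
      exact (MeasurableSet.univ.prod (hVo c).measurableSet).inter hE
    · rintro _ ⟨c, rfl⟩
      exact inter_subset_right
    · intro ω x hx
      obtain ⟨c, hc⟩ := hV x
      exact mem_iUnion₂.2 ⟨_, ⟨c, rfl⟩, ⟨⟨mem_univ _, hc⟩, hx⟩⟩
    · rintro _ ⟨c, rfl⟩
      refine Eventually.of_forall fun ω => ⟨V c, hVo c, ?_⟩
      ext x
      simp [fib]
  have hle : relCoverEnt P (skew ϑ T) (range fun c => ((univ : Set Ω) ×ˢ V c) ∩ E) Q ≤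
      condTailEnt P E (skew ϑ T) Q :=
    le_iSup₂ (f := fun R (_ : R ∈ {R | IsOpenRandomCover P E R}) =>
      relCoverEnt P (skew ϑ T) R Q) _ hopen
  refine le_trans (limsup_le_aux _ _ _ ε fun n hn => ?_)
    (add_le_add (add_le_add le_rfl hle) le_rfl)
  have hst := step P hP hE hTm hmaps hΓ hHm hH μ hμP hμH hμΓ hQf hQ hPQm hPQf hPQd hPQH
    hRc hRm hRd hRU.ge V hVo hV s hs g hgm hg n hn
  have hn0 : (n : ℝ≥0∞) ≠ 0 := by exact_mod_cast hn.ne'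
  have hnt : (n : ℝ≥0∞) ≠ ∞ := ENNReal.natCast_ne_top n
  refine (ENNReal.div_le_div_right hst _).trans ?_
  rw [ENNReal.add_div, ENNReal.add_div, ENNReal.ofReal_div_of_pos (by exact_mod_cast hn),
    ENNReal.ofReal_natCast, mul_comm (n : ℝ≥0∞), ENNReal.mul_div_cancel_right hn0 hnt]
  gcongr
end

/-- `h_μ(Γ | D_H) ≤ h_μ(π_E⁻¹Q | D_H) + h(Θ | Q)` for each finite
measurable partition `Q` of `E` and each `μ ∈ I_P(H)`. -/
theorem relEnt_le_pullback_add_condTailEnt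
    {Ω X Y : Type*} [MeasurableSpace Ω] [MeasurableSpace.CountablyGenerated Ω]
    [MetricSpace X] [CompactSpace X] [MeasurableSpace X] [BorelSpace X]
    [MetricSpace Y] [CompactSpace Y] [MeasurableSpace Y] [BorelSpace Y]
    (P : Measure Ω) [IsProbabilityMeasure P] (hP : P.IsComplete)
    (ϑ : Ω → Ω) (E : Set (Ω × X)) (hE : MeasurableSet E) (hEc : ∀ ω, IsCompact (fib E ω))
    (G : Set (Ω × Y)) (hG : MeasurableSet G) (hGc : ∀ ω, IsCompact (fib G ω))
    (T : Ω → X → X) (hT : IsBundleRDS P ϑ E T)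
    (S : Ω → Y → Y) (hS : IsBundleRDS P ϑ G S) :
    let Hset : Set (Ω × Y × X) := {p | p.2.1 ∈ fib G p.1 ∧ p.2.2 ∈ fib E p.1}
    let Γ : Ω × Y × X → Ω × Y × X := fun p => (ϑ p.1, S p.1 p.2.1, T p.1 p.2.2)
    ∀ μ : Measure (Ω × Y × X), IsProbabilityMeasure μ →
      μ.map Prod.fst = P → μ Hset = 1 → μ.map Γ = μ →
      ∀ Q : Set (Set (Ω × X)), Q.Finite → IsCountablePartition E Q →
        relEnt (firstPairSigma Ω Y X) μ Γ Hset ≤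
          relEntPart (firstPairSigma Ω Y X) μ Γ
            {s | ∃ q ∈ Q, s = (fun p : Ω × Y × X => (p.1, p.2.2)) ⁻¹' q ∩ Hset} +
          condTailEnt P E (skew ϑ T) Q := by
  intro Hset Γ μ hμ hμP hμH hμΓ Q hQf hQ
  exact final P hP ϑ E hE G hG T hT S hS μ hμP hμH hμΓ Q hQf hQ

end RelTail
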